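/- arXiv:2209.01689 — 2 statements merged into one kernel-verified Lean document; each statement's English description precedes it below -/
import Mathlib

section
/- Assume A + κ ≥ 1, let θ < b < 1 and T ≥ 5. Then the set Z(b,T) of zeros of ζ with real part at least b and imaginary part of absolute value at most T is finite, and #Z(b,T) ≤ (1/(b−θ))·( (1/2)·T·log T + (2·log(A+κ) + log(1/(b−θ)) + 3)·T ). -/
open scoped BigOperators Real

/-- The multiplicative norm on the Beurling generalized integers `ℕ →₀ ℕ`
generated by the primes `q i`. -/
noncomputable def bNorm (q : ℕ → ℝ) (g : ℕ →₀ ℕ) : ℝ :=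
  g.prod fun i k => q i ^ k

/-- The integer counting function `N(x)`. -/
noncomputable def bN (q : ℕ → ℝ) (x : ℝ) : ℕ :=
  {g : ℕ →₀ ℕ | bNorm q g ≤ x}.ncard

/-- The remainder `R(x) = N(x) - κ(x-1)`. -/
noncomputable def bR (q : ℕ → ℝ) (κ : ℝ) (x : ℝ) : ℝ :=
  (bN q x : ℝ) - κ * (x - 1)

/-- The Beurling zeta function, via the analytic continuation formula
`ζ(s) = κ/(s-1) + s ∫_1^∞ R(x) x^(-s-1) dx`. -/
noncomputable def bZeta (q : ℕ → ℝ) (κ : ℝ) (s : ℂ) : ℂ :=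
  (κ : ℂ) / (s - 1) + s * ∫ x in Set.Ioi (1 : ℝ), (bR q κ x : ℂ) * (x : ℂ) ^ (-s - 1)

/-- The partial sums `ζ_X(s) = ∑_{‖g‖ ≤ X} ‖g‖^{-s}`. -/
noncomputable def bZetaX (q : ℕ → ℝ) (X : ℝ) (s : ℂ) : ℂ :=
  ∑ᶠ g ∈ {g : ℕ →₀ ℕ | bNorm q g ≤ X}, (bNorm q g : ℂ) ^ (-s)

section ZeroDensity

open MeasureTheory Set Filter Topology ComplexConjugate

/-- The factor of a half-plane `Re s > a` vanishing at `ρ` and of modulus one on the boundary. -/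
noncomputable def halfPlaneFactor (a : ℝ) (ρ s : ℂ) : ℂ :=
  (s - ρ) / (s + conj ρ - 2 * a)

theorem halfPlaneFactor_denom_ne_zero {a : ℝ} {ρ s : ℂ} (hρ : a < ρ.re) (hs : a < s.re) :
    s + conj ρ - 2 * a ≠ 0 := by
  intro h
  have := congrArg Complex.re h
  simp at this
  linarith

theorem exists_eq_halfPlaneFactor_mul {a : ℝ} {ρ : ℂ} (hρ : a < ρ.re) {f : ℂ → ℂ}
    (hf : DifferentiableOn ℂ f {s | a < s.re}) (hf1 : ∀ s : ℂ, a < s.re → ‖f s‖ ≤ 1)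
    (h0 : f ρ = 0) :
    ∃ g : ℂ → ℂ, DifferentiableOn ℂ g {s | a < s.re} ∧ (∀ s : ℂ, a < s.re → ‖g s‖ ≤ 1) ∧
      ∀ s : ℂ, a < s.re → f s = halfPlaneFactor a ρ s * g s := by
  set w : ℂ → ℂ := fun z => (ρ + (conj ρ - 2 * a) * z) / (1 - z) with hw
  have hne : ∀ z ∈ Metric.ball (0 : ℂ) 1, 1 - z ≠ 0 := by
    intro z hz h
    rw [sub_eq_zero] at h
    simp [← h] at hz
  have hwre : ∀ z ∈ Metric.ball (0 : ℂ) 1, a < (w z).re := by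
    intro z hz
    have h1 : w z - a = (ρ.re - a) * ((1 + z) / (1 - z)) + ρ.im * Complex.I := by
      have := hne z hz
      simp only [hw]
      have h2 : conj ρ = ρ.re - ρ.im * Complex.I := by
        apply Complex.ext <;> simp
      rw [h2]
      nth_rewrite 1 [← Complex.re_add_im ρ]
      field_simp
      ring
    have h2 : 0 < ((1 + z) / (1 - z)).re := by
      have hn : 0 < Complex.normSq (1 - z) := Complex.normSq_pos.2 (hne z hz)
      have hz' : Complex.normSq z < 1 := by
        rw [Complex.normSq_eq_norm_sq]
        have : ‖z‖ < 1 := by simpa using hz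
        nlinarith [norm_nonneg z]
      rw [Complex.normSq_apply] at hz'
      rw [Complex.div_re, ← add_div]
      apply div_pos _ hn
      simp
      nlinarith
    have h3 := congrArg Complex.re h1
    rw [← Complex.ofReal_sub] at h3
    simp only [Complex.sub_re, Complex.ofReal_re, Complex.add_re, Complex.re_ofReal_mul,
      Complex.I_re, mul_zero, add_zero] at h3
    have := mul_pos (sub_pos.2 hρ) h2
    linarith
  have hfac : ∀ s : ℂ, a < s.re → halfPlaneFactor a ρ s ∈ Metric.ball (0 : ℂ) 1 := by
    intro s hs
    have hd := halfPlaneFactor_denom_ne_zero hρ hs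
    rw [mem_ball_zero_iff, halfPlaneFactor, norm_div, div_lt_one (norm_pos_iff.2 hd),
      ← sq_lt_sq₀ (norm_nonneg _) (norm_nonneg _), ← Complex.normSq_eq_norm_sq,
      ← Complex.normSq_eq_norm_sq, Complex.normSq_apply, Complex.normSq_apply]
    simp
    nlinarith [mul_pos (sub_pos.2 hρ) (sub_pos.2 hs)]
  have hinv : ∀ s : ℂ, a < s.re → w (halfPlaneFactor a ρ s) = s := by
    intro s hs
    have hd := halfPlaneFactor_denom_ne_zero hρ hs
    have h1 := hne _ (hfac s hs)
    simp only [hw]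
    rw [div_eq_iff h1]
    simp only [halfPlaneFactor]
    field_simp
    ring
  set F : ℂ → ℂ := fun z => f (w z) with hF
  have hF0 : F 0 = 0 := by simp [hF, hw, h0]
  have hwd : DifferentiableOn ℂ w (Metric.ball 0 1) := by
    apply DifferentiableOn.div _ _ hne <;> fun_prop
  have hFd : DifferentiableOn ℂ F (Metric.ball 0 1) := hf.comp hwd hwre
  have hmaps : MapsTo F (Metric.ball 0 1) (Metric.closedBall (F 0) 1) := by
    intro z hz
    rw [hF0, mem_closedBall_zero_iff]
    exact hf1 _ (hwre z hz)
  refine ⟨fun s => dslope F 0 (halfPlaneFactor a ρ s), ?_, ?_, ?_⟩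
  · have h1 : DifferentiableOn ℂ (dslope F 0) (Metric.ball 0 1) :=
      (Complex.differentiableOn_dslope (Metric.ball_mem_nhds _ one_pos)).2 hFd
    refine h1.comp (t := Metric.ball 0 1) ?_ hfac
    unfold halfPlaneFactor
    apply DifferentiableOn.div
    · fun_prop
    · fun_prop
    · exact fun s hs => halfPlaneFactor_denom_ne_zero hρ hs
  · intro s hs
    simpa using Complex.norm_dslope_le_div_of_mapsTo_ball hFd hmaps (hfac s hs)
  · intro s hs
    have := sub_smul_dslope F 0 (halfPlaneFactor a ρ s)
    rw [sub_zero, hF0, sub_zero, smul_eq_mul] at this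
    rw [this, hF]
    simp only [hinv s hs]

theorem norm_le_prod_norm_halfPlaneFactor {a : ℝ} (Z : Finset ℂ) (hZ : ∀ ρ ∈ Z, a < ρ.re)
    {f : ℂ → ℂ} (hf : DifferentiableOn ℂ f {s | a < s.re})
    (hf1 : ∀ s : ℂ, a < s.re → ‖f s‖ ≤ 1) (h0 : ∀ ρ ∈ Z, f ρ = 0) {s : ℂ} (hs : a < s.re) :
    ‖f s‖ ≤ ∏ ρ ∈ Z, ‖halfPlaneFactor a ρ s‖ := by
  induction Z using Finset.induction_on generalizing f with
  | empty => simpa using hf1 s hs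
  | insert ρ Z hρ ih =>
    rw [Finset.forall_mem_insert] at hZ h0
    obtain ⟨g, hg, hg1, hfg⟩ := exists_eq_halfPlaneFactor_mul hZ.1 hf hf1 h0.1
    rw [Finset.prod_insert hρ, hfg s hs, norm_mul]
    refine mul_le_mul_of_nonneg_left (ih hZ.2 hg hg1 fun ρ' hρ' => ?_) (norm_nonneg _)
    have h := hfg ρ' (hZ.2 ρ' hρ')
    rw [h0.2 ρ' hρ', eq_comm, mul_eq_zero] at h
    refine h.resolve_left (div_ne_zero (sub_ne_zero.2 ?_)
      (halfPlaneFactor_denom_ne_zero hZ.1 (hZ.2 ρ' hρ')))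
    rintro rfl
    exact hρ hρ'

theorem le_neg_log_norm_halfPlaneFactor {a σ t x : ℝ} {ρ : ℂ} (hx : a + x ≤ ρ.re) (hx0 : 0 < x)
    (hσ : ρ.re ≤ σ) (hne : ρ ≠ σ + t * Complex.I) :
    2 * (σ - a) * x / ((σ - a) ^ 2 + x ^ 2 + (t - ρ.im) ^ 2) ≤
      -Real.log ‖halfPlaneFactor a ρ (σ + t * Complex.I)‖ := by
  set p := σ - a with hp
  set y := ρ.re - a with hy
  set τ := t - ρ.im with hτ
  have hxy : x ≤ y := by linarith
  have hyp : y ≤ p := by linarith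
  have hn : 0 < (p - y) ^ 2 + τ ^ 2 := by
    by_contra! h
    have h1 : p - y = 0 := by nlinarith [sq_nonneg (p - y), sq_nonneg τ]
    have h2 : τ = 0 := by nlinarith [sq_nonneg (p - y), sq_nonneg τ]
    apply hne
    apply Complex.ext <;> simp <;> linarith
  have hsq : ‖halfPlaneFactor a ρ (σ + t * Complex.I)‖ ^ 2 =
      ((p - y) ^ 2 + τ ^ 2) / ((p + y) ^ 2 + τ ^ 2) := by
    rw [halfPlaneFactor, norm_div, div_pow, ← Complex.normSq_eq_norm_sq,
      ← Complex.normSq_eq_norm_sq, Complex.normSq_apply, Complex.normSq_apply]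
    simp
    rw [hp, hy, hτ]
    congr 1 <;> ring
  have hlog : -Real.log ‖halfPlaneFactor a ρ (σ + t * Complex.I)‖ =
      Real.log (1 + 4 * p * y / ((p - y) ^ 2 + τ ^ 2)) / 2 := by
    have h1 : 1 + 4 * p * y / ((p - y) ^ 2 + τ ^ 2) =
        (‖halfPlaneFactor a ρ (σ + t * Complex.I)‖ ^ 2)⁻¹ := by
      rw [hsq, inv_div]
      field_simp
      ring
    rw [h1, Real.log_inv, Real.log_pow]
    push_cast
    ring
  have hy0 : 0 < y := by linarith
  have hp0 : 0 < p := by linarith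
  rw [hlog]
  calc 2 * p * x / (p ^ 2 + x ^ 2 + τ ^ 2) ≤ 2 * p * y / (p ^ 2 + y ^ 2 + τ ^ 2) := by
        rw [div_le_div_iff₀ (by positivity) (by positivity)]
        have h1 : x * y ≤ p ^ 2 + τ ^ 2 := by nlinarith [sq_nonneg τ]
        nlinarith [mul_nonneg (mul_nonneg hp0.le (sub_nonneg.2 hxy)) (sub_nonneg.2 h1)]
    _ = (2 * (4 * p * y / ((p - y) ^ 2 + τ ^ 2)) /
          (4 * p * y / ((p - y) ^ 2 + τ ^ 2) + 2)) / 2 := by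
        field_simp
        ring
    _ ≤ _ := by
        gcongr
        exact Real.le_log_one_add_of_nonneg (by positivity)

section MultiplicativeSeries

variable {𝕜 : Type*} [NormedField 𝕜] [CompleteSpace 𝕜]

/-- The elements of the free monoid not involving the first `n` generators. -/
def roughSet (n : ℕ) : Set (ℕ →₀ ℕ) := {g | ∀ i < n, g i = 0}

theorem zero_mem_roughSet (n : ℕ) : (0 : ℕ →₀ ℕ) ∈ roughSet n := fun _ _ => rfl

theorem tsum_indicator_roughSet_succ {u : (ℕ →₀ ℕ) → 𝕜} (hmul : ∀ g h, u (g + h) = u g * u h)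
    (hu : Summable fun g => ‖u g‖) (n : ℕ) :
    ∑' g, (roughSet (n + 1)).indicator u g =
      (∑' g, (roughSet n).indicator u g) * (1 - u (Finsupp.single n 1)) := by
  have hs : ∀ S : Set (ℕ →₀ ℕ), Summable (S.indicator u) := fun S => hu.of_norm.indicator S
  set S' : Set (ℕ →₀ ℕ) := {g | g ∈ roughSet n ∧ g n ≠ 0}
  have hsplit : (roughSet n).indicator u = fun g =>
      (roughSet (n + 1)).indicator u g + S'.indicator u g := by
    funext g
    by_cases h : g ∈ roughSet n
    · by_cases h0 : g n = 0
      · have h1 : g ∈ roughSet (n + 1) := by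
          intro i hi
          rcases Nat.lt_succ_iff_lt_or_eq.1 hi with hi | rfl
          · exact h i hi
          · exact h0
        simp [h, h1, S', h0]
      · have h1 : g ∉ roughSet (n + 1) := fun hg => h0 (hg n n.lt_succ_self)
        simp [h, h1, S', h0]
    · have h1 : g ∉ roughSet (n + 1) := fun hg => h fun i hi => hg i (hi.trans n.lt_succ_self)
      simp [h, h1, S']
  have hshift : ∑' g, S'.indicator u g =
      (∑' g, (roughSet n).indicator u g) * u (Finsupp.single n 1) := by
    have hinj : Function.Injective fun g : ℕ →₀ ℕ => g + Finsupp.single n 1 :=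
      fun g h hgh => add_right_cancel hgh
    rw [← hinj.tsum_eq, ← tsum_mul_right]
    · refine tsum_congr fun g => ?_
      have hiff : g + Finsupp.single n 1 ∈ S' ↔ g ∈ roughSet n := by
        constructor
        · intro h i hi
          have h1 := h.1 i hi
          simpa [Finsupp.single_apply, hi.ne'] using h1
        · intro h
          refine ⟨fun i hi => ?_, by simp⟩
          simpa [Finsupp.single_apply, hi.ne'] using h i hi
      by_cases h : g ∈ roughSet n
      · rw [indicator_of_mem (hiff.2 h), indicator_of_mem h, hmul]
      · rw [indicator_of_notMem (mt hiff.1 h), indicator_of_notMem h, zero_mul]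
    · intro g hg
      have hg' : g ∈ S' := by
        by_contra h
        exact hg (indicator_of_notMem h u)
      refine ⟨g - Finsupp.single n 1, ?_⟩
      refine tsub_add_cancel_of_le ?_
      rw [Finsupp.single_le_iff]
      exact Nat.one_le_iff_ne_zero.2 hg'.2
  have htot : ∑' g, (roughSet n).indicator u g =
      ∑' g, (roughSet (n + 1)).indicator u g + ∑' g, S'.indicator u g := by
    rw [← (hs _).tsum_add (hs _), hsplit]
  rw [hshift] at htot
  rw [mul_sub, mul_one]
  exact eq_sub_of_add_eq htot.symm

theorem tsum_mul_prod_one_sub_eq {u : (ℕ →₀ ℕ) → 𝕜} (hmul : ∀ g h, u (g + h) = u g * u h)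
    (hu : Summable fun g => ‖u g‖) (n : ℕ) :
    (∑' g, u g) * ∏ i ∈ Finset.range n, (1 - u (Finsupp.single i 1)) =
      ∑' g, (roughSet n).indicator u g := by
  induction n with
  | zero => simp [roughSet]
  | succ n ih => rw [Finset.prod_range_succ, ← mul_assoc, ih, tsum_indicator_roughSet_succ hmul hu]

theorem tendsto_tsum_indicator_roughSet {u : (ℕ →₀ ℕ) → 𝕜} (h0 : u 0 = 1)
    (hu : Summable fun g => ‖u g‖) :
    Tendsto (fun n => ∑' g, (roughSet n).indicator u g) atTop (𝓝 1) := by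
  have h1 : (1 : 𝕜) = ∑' g : ℕ →₀ ℕ, ({0} : Set (ℕ →₀ ℕ)).indicator u g := by
    rw [tsum_eq_single 0]
    · simp [h0]
    · intro g hg
      simp [hg]
  rw [h1]
  refine tendsto_tsum_of_dominated_convergence hu (fun g => ?_) ?_
  · by_cases hg : g = 0
    · subst hg
      simp [zero_mem_roughSet]
    · obtain ⟨i, hi⟩ := Finsupp.ne_iff.1 hg
      refine tendsto_const_nhds.congr' ?_
      filter_upwards [eventually_gt_atTop i] with n hn
      rw [indicator_of_notMem (by simpa using hg),
        indicator_of_notMem fun h : g ∈ roughSet n => hi (h i hn)]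
  · exact Eventually.of_forall fun n g => norm_indicator_le_norm_self _ _

theorem one_le_norm_tsum_mul_tsum_norm {u : (ℕ →₀ ℕ) → 𝕜} (h0 : u 0 = 1)
    (hmul : ∀ g h, u (g + h) = u g * u h) (hu : Summable fun g => ‖u g‖)
    (hlt : ∀ i, ‖u (Finsupp.single i 1)‖ < 1) :
    1 ≤ ‖∑' g, u g‖ * ∑' g, ‖u g‖ := by
  have hu' : Summable fun g => ‖(fun g => ‖u g‖) g‖ := by simpa using hu
  have hbound : ∀ n, ‖∑' g, (roughSet n).indicator u g‖ ≤ ‖∑' g, u g‖ * ∑' g, ‖u g‖ := by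
    intro n
    rw [← tsum_mul_prod_one_sub_eq hmul hu n, norm_mul, norm_prod]
    refine mul_le_mul_of_nonneg_left ?_ (norm_nonneg _)
    set r : ℕ → ℝ := fun i => ‖u (Finsupp.single i 1)‖
    have h1 : 1 ≤ (∑' g, ‖u g‖) * ∏ i ∈ Finset.range n, (1 - r i) := by
      rw [tsum_mul_prod_one_sub_eq (u := fun g => ‖u g‖) (by simp [hmul]) hu' n]
      refine le_trans ?_ ((hu.indicator (roughSet n)).le_tsum 0
        fun g _ => indicator_nonneg (fun _ _ => norm_nonneg _) g)
      simp [zero_mem_roughSet, h0]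
    have hpos : 0 < ∏ i ∈ Finset.range n, (1 - r i) :=
      Finset.prod_pos fun i _ => sub_pos.2 (hlt i)
    have h2 : (∏ i ∈ Finset.range n, ‖1 - u (Finsupp.single i 1)‖) *
        ∏ i ∈ Finset.range n, (1 - r i) ≤ 1 := by
      rw [← Finset.prod_mul_distrib]
      refine Finset.prod_le_one (fun i _ => mul_nonneg (norm_nonneg _) (sub_pos.2 (hlt i)).le)
        fun i _ => ?_
      have h3 : ‖1 - u (Finsupp.single i 1)‖ ≤ 1 + r i := (norm_sub_le _ _).trans (by simp [r])
      have h4 : r i < 1 := hlt i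
      nlinarith [sq_nonneg (r i)]
    exact le_of_mul_le_mul_right (h2.trans h1) hpos
  have := (tendsto_tsum_indicator_roughSet h0 hu).norm
  rw [norm_one] at this
  exact le_of_tendsto' this hbound

end MultiplicativeSeries

section Beurling

variable {q : ℕ → ℝ}

theorem bNorm_zero : bNorm q 0 = 1 := by simp [bNorm]

theorem bNorm_add (g h : ℕ →₀ ℕ) : bNorm q (g + h) = bNorm q g * bNorm q h :=
  Finsupp.prod_add_index' (by simp) fun i => pow_add (q i)

theorem bNorm_single (i : ℕ) : bNorm q (Finsupp.single i 1) = q i := by simp [bNorm]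

theorem one_le_bNorm (hq : ∀ i, 1 < q i) (g : ℕ →₀ ℕ) : 1 ≤ bNorm q g := by
  rw [bNorm, Finsupp.prod, ← Finset.prod_const_one (s := g.support)]
  exact Finset.prod_le_prod (fun _ _ => zero_le_one) fun i _ => one_le_pow₀ (hq i).le

theorem monotone_bN (hfin : ∀ x : ℝ, {g : ℕ →₀ ℕ | bNorm q g ≤ x}.Finite) : Monotone (bN q) :=
  fun _ y hxy => ncard_le_ncard (fun _ hg => le_trans hg hxy) (hfin y)

theorem measurable_bN (hfin : ∀ x : ℝ, {g : ℕ →₀ ℕ | bNorm q g ≤ x}.Finite) :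
    Measurable fun x => (bN q x : ℝ) :=
  measurable_from_top.comp (monotone_bN hfin).measurable

theorem measurable_bR (hfin : ∀ x : ℝ, {g : ℕ →₀ ℕ | bNorm q g ≤ x}.Finite) (κ : ℝ) :
    Measurable (bR q κ) := by
  unfold bR
  exact (measurable_bN hfin).sub (by fun_prop)

variable {κ A θ : ℝ}

theorem bN_le (hκ : 0 < κ) (hA : 0 < A) (hθ1 : θ < 1)
    (hAx : ∀ x : ℝ, 1 ≤ x → |bR q κ x| ≤ A * x ^ θ) {x : ℝ} (hx : 1 ≤ x) :
    (bN q x : ℝ) ≤ (A + κ) * x := by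
  have h1 := (le_abs_self _).trans (hAx x hx)
  have h2 : x ^ θ ≤ x := Real.rpow_le_self_of_one_le hx hθ1.le
  unfold bR at h1
  nlinarith

theorem norm_cpow_neg_sub_one {x : ℝ} (hx : 0 < x) (s : ℂ) :
    ‖(x : ℂ) ^ (-s - 1)‖ = x ^ (-s.re - 1) := by
  rw [Complex.norm_cpow_eq_rpow_re_of_pos hx]
  simp

theorem integrableOn_bN_mul_rpow (hfin : ∀ x : ℝ, {g : ℕ →₀ ℕ | bNorm q g ≤ x}.Finite)
    (hκ : 0 < κ) (hA : 0 < A) (hθ1 : θ < 1)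
    (hAx : ∀ x : ℝ, 1 ≤ x → |bR q κ x| ≤ A * x ^ θ) {σ : ℝ} (hσ : 1 < σ) :
    IntegrableOn (fun x : ℝ => (bN q x : ℝ) * x ^ (-σ - 1)) (Ioi 1) := by
  have h1 : IntegrableOn (fun x : ℝ => (A + κ) * x ^ (-σ)) (Ioi 1) :=
    (integrableOn_Ioi_rpow_of_lt (by linarith) one_pos).const_mul _
  refine h1.mono' ((measurable_bN hfin).mul (by fun_prop)).aestronglyMeasurable ?_
  filter_upwards [ae_restrict_mem measurableSet_Ioi] with x hx
  have hx0 : (0 : ℝ) < x := one_pos.trans hx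
  rw [norm_mul, Real.norm_of_nonneg (Nat.cast_nonneg _),
    Real.norm_of_nonneg (Real.rpow_nonneg hx0.le _), Real.rpow_sub_one hx0.ne']
  calc (bN q x : ℝ) * (x ^ (-σ) / x) ≤ (A + κ) * x * (x ^ (-σ) / x) := by
        gcongr
        exact bN_le hκ hA hθ1 hAx (le_of_lt hx)
    _ = _ := by field_simp

/-- The indicator contribution of one generalized integer to the counting integral. -/
noncomputable def bTerm (q : ℕ → ℝ) (s : ℂ) (g : ℕ →₀ ℕ) (x : ℝ) : ℂ :=
  (Ici (bNorm q g)).indicator (fun x : ℝ => (x : ℂ) ^ (-s - 1)) x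

theorem integrableOn_cpow_neg_sub_one {s : ℂ} (hs : 0 < s.re) {c : ℝ} (hc : 0 < c) :
    IntegrableOn (fun x : ℝ => (x : ℂ) ^ (-s - 1)) (Ioi c) :=
  integrableOn_Ioi_cpow_of_lt (by simp; linarith) hc

theorem integral_cpow_neg_sub_one {s : ℂ} (hs : 0 < s.re) {c : ℝ} (hc : 0 < c) :
    ∫ x in Ioi c, (x : ℂ) ^ (-s - 1) = (c : ℂ) ^ (-s) / s := by
  rw [integral_Ioi_cpow_of_lt (by simp; linarith) hc, sub_add_cancel, neg_div_neg_eq]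

theorem integral_bTerm (hq : ∀ i, 1 < q i) {s : ℂ} (hs : 0 < s.re) (g : ℕ →₀ ℕ) :
    ∫ x in Ioi (1 : ℝ), bTerm q s g x = (bNorm q g : ℂ) ^ (-s) / s := by
  have h1 := one_le_bNorm hq g
  unfold bTerm
  rw [setIntegral_indicator measurableSet_Ici,
    ← integral_cpow_neg_sub_one hs (one_pos.trans_le h1)]
  rcases h1.eq_or_lt with h | h
  · rw [← h, inter_eq_self_of_subset_left Ioi_subset_Ici_self]
  · rw [inter_eq_self_of_subset_right (Ici_subset_Ioi.2 h), integral_Ici_eq_integral_Ioi]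

theorem integrableOn_bTerm {s : ℂ} (hs : 0 < s.re) (g : ℕ →₀ ℕ) :
    IntegrableOn (bTerm q s g) (Ioi 1) :=
  (integrableOn_cpow_neg_sub_one hs one_pos).indicator measurableSet_Ici

theorem norm_bTerm {s : ℂ} (g : ℕ →₀ ℕ) {x : ℝ} (hx : 1 < x) :
    ‖bTerm q s g x‖ = (Ici (bNorm q g)).indicator (fun x : ℝ => x ^ (-s.re - 1)) x := by
  unfold bTerm
  rw [norm_indicator_eq_indicator_norm]
  by_cases h : x ∈ Ici (bNorm q g)
  · rw [indicator_of_mem h, indicator_of_mem h, norm_cpow_neg_sub_one (one_pos.trans hx)]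
  · rw [indicator_of_notMem h, indicator_of_notMem h]

theorem tsum_bTerm (hfin : ∀ x : ℝ, {g : ℕ →₀ ℕ | bNorm q g ≤ x}.Finite) (s : ℂ) (x : ℝ) :
    ∑' g, bTerm q s g x = (bN q x : ℂ) * (x : ℂ) ^ (-s - 1) := by
  rw [tsum_eq_sum (s := (hfin x).toFinset)]
  · rw [Finset.sum_congr rfl (g := fun _ => (x : ℂ) ^ (-s - 1)), Finset.sum_const, nsmul_eq_mul,
      bN, ncard_eq_toFinset_card _ (hfin x)]
    intro g hg
    exact indicator_of_mem (by simpa using hg) _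
  · intro g hg
    exact indicator_of_notMem (by simpa using hg) _

theorem summable_integral_norm_bTerm (hfin : ∀ x : ℝ, {g : ℕ →₀ ℕ | bNorm q g ≤ x}.Finite)
    (hκ : 0 < κ) (hA : 0 < A) (hθ1 : θ < 1)
    (hAx : ∀ x : ℝ, 1 ≤ x → |bR q κ x| ≤ A * x ^ θ) {s : ℂ} (hs : 1 < s.re) :
    Summable fun g => ∫ x in Ioi (1 : ℝ), ‖bTerm q s g x‖ := by
  refine summable_of_sum_le (c := ∫ x in Ioi (1 : ℝ), (bN q x : ℝ) * x ^ (-s.re - 1))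
    (fun g => integral_nonneg fun x => norm_nonneg _) fun u => ?_
  have hs0 : 0 < s.re := one_pos.trans hs
  rw [← integral_finsetSum _ fun g _ => (integrableOn_bTerm hs0 g).norm]
  refine setIntegral_mono_on (integrable_finsetSum _ fun g _ => (integrableOn_bTerm hs0 g).norm)
    (integrableOn_bN_mul_rpow hfin hκ hA hθ1 hAx hs) measurableSet_Ioi fun x hx => ?_
  have hx0 : (0 : ℝ) < x := one_pos.trans hx
  classical
  calc ∑ g ∈ u, ‖bTerm q s g x‖
      = ∑ g ∈ u, if bNorm q g ≤ x then x ^ (-s.re - 1) else 0 := by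
        refine Finset.sum_congr rfl fun g _ => ?_
        rw [norm_bTerm g hx, indicator_apply]
        rfl
    _ = ((u.filter fun g => bNorm q g ≤ x).card : ℝ) * x ^ (-s.re - 1) := by
        rw [← Finset.sum_filter, Finset.sum_const, nsmul_eq_mul]
    _ ≤ _ := by
        gcongr
        rw [bN, ncard_eq_toFinset_card _ (hfin x)]
        refine Finset.card_le_card fun g hg => ?_
        simpa using (Finset.mem_filter.1 hg).2

theorem norm_bNorm_cpow (hq : ∀ i, 1 < q i) (s : ℂ) (g : ℕ →₀ ℕ) :
    ‖(bNorm q g : ℂ) ^ (-s)‖ = bNorm q g ^ (-s.re) := by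
  rw [Complex.norm_cpow_eq_rpow_re_of_pos (one_pos.trans_le (one_le_bNorm hq g))]
  simp

theorem summable_norm_bNorm_cpow (hq : ∀ i, 1 < q i)
    (hfin : ∀ x : ℝ, {g : ℕ →₀ ℕ | bNorm q g ≤ x}.Finite)
    (hκ : 0 < κ) (hA : 0 < A) (hθ1 : θ < 1)
    (hAx : ∀ x : ℝ, 1 ≤ x → |bR q κ x| ≤ A * x ^ θ) {s : ℂ} (hs : 1 < s.re) :
    Summable fun g => ‖(bNorm q g : ℂ) ^ (-s)‖ := by
  have hs0 : 0 < s.re := one_pos.trans hs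
  have h := (summable_integral_norm_bTerm hfin hκ hA hθ1 hAx hs).mul_left ‖s‖
  refine h.of_nonneg_of_le (fun g => norm_nonneg _) fun g => ?_
  have h1 := norm_integral_le_integral_norm (μ := volume.restrict (Ioi 1)) (bTerm q s g)
  rw [integral_bTerm hq hs0, norm_div] at h1
  have hsn : 0 < ‖s‖ := norm_pos_iff.2 fun h => by simp [h] at hs0
  rwa [div_le_iff₀' hsn] at h1

theorem bZeta_eq_tsum (hq : ∀ i, 1 < q i)
    (hfin : ∀ x : ℝ, {g : ℕ →₀ ℕ | bNorm q g ≤ x}.Finite)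
    (hκ : 0 < κ) (hA : 0 < A) (hθ1 : θ < 1)
    (hAx : ∀ x : ℝ, 1 ≤ x → |bR q κ x| ≤ A * x ^ θ) {s : ℂ} (hs : 1 < s.re) :
    bZeta q κ s = ∑' g, (bNorm q g : ℂ) ^ (-s) := by
  have hs0 : 0 < s.re := one_pos.trans hs
  have hsne : s ≠ 0 := fun h => by simp [h] at hs0
  have hs1 : s - 1 ≠ 0 := fun h => by
    rw [sub_eq_zero] at h
    simp [h] at hs
  have hsum := hasSum_integral_of_summable_integral_norm (μ := volume.restrict (Ioi 1))
    (fun g => integrableOn_bTerm (q := q) hs0 g)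
    (summable_integral_norm_bTerm hfin hκ hA hθ1 hAx hs)
  simp only [integral_bTerm hq hs0, tsum_bTerm hfin] at hsum
  have htot := hsum.tsum_eq
  rw [tsum_div_const, div_eq_iff hsne] at htot
  rw [htot]
  have hN : IntegrableOn (fun x : ℝ => (bN q x : ℂ) * (x : ℂ) ^ (-s - 1)) (Ioi 1) := by
    refine (integrableOn_bN_mul_rpow hfin hκ hA hθ1 hAx hs).mono' ?_ ?_
    · refine Measurable.aestronglyMeasurable ?_
      have := Complex.measurable_ofReal.comp (measurable_bN hfin)
      simp only [Function.comp_def, Complex.ofReal_natCast] at this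
      exact this.mul (by fun_prop)
    · filter_upwards [ae_restrict_mem measurableSet_Ioi] with x hx
      rw [norm_mul, norm_cpow_neg_sub_one (one_pos.trans hx), Complex.norm_natCast]
  have hx1 : IntegrableOn (fun x : ℝ => (x : ℂ) ^ (-(s - 1) - 1)) (Ioi 1) :=
    integrableOn_cpow_neg_sub_one (by simpa using hs) one_pos
  have hx0 := integrableOn_cpow_neg_sub_one hs0 one_pos
  have hsplit : ∀ x ∈ Ioi (1 : ℝ), (bR q κ x : ℂ) * (x : ℂ) ^ (-s - 1) =
      (bN q x : ℂ) * (x : ℂ) ^ (-s - 1) -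
        (κ : ℂ) * ((x : ℂ) ^ (-(s - 1) - 1) - (x : ℂ) ^ (-s - 1)) := by
    intro x hx
    have hxne : (x : ℂ) ≠ 0 := Complex.ofReal_ne_zero.2 (one_pos.trans hx).ne'
    rw [show -(s - 1) - 1 = (-s - 1) + 1 by ring, Complex.cpow_add _ _ hxne, Complex.cpow_one, bR]
    push_cast
    ring
  have hdiff : IntegrableOn (fun x : ℝ =>
      (κ : ℂ) * ((x : ℂ) ^ (-(s - 1) - 1) - (x : ℂ) ^ (-s - 1))) (Ioi 1) :=
    (hx1.sub hx0).const_mul _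
  rw [bZeta, setIntegral_congr_fun measurableSet_Ioi hsplit, integral_sub hN hdiff,
    integral_const_mul, integral_sub hx1 hx0,
    integral_cpow_neg_sub_one (by simpa using hs) one_pos, integral_cpow_neg_sub_one hs0 one_pos]
  simp only [Complex.ofReal_one, Complex.one_cpow]
  field_simp
  ring

theorem norm_integral_bR_le (hAx : ∀ x : ℝ, 1 ≤ x → |bR q κ x| ≤ A * x ^ θ) {s : ℂ}
    (hs : θ < s.re) :
    ‖∫ x in Ioi (1 : ℝ), (bR q κ x : ℂ) * (x : ℂ) ^ (-s - 1)‖ ≤ A / (s.re - θ) := by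
  have hint : IntegrableOn (fun x : ℝ => A * x ^ (θ - s.re - 1)) (Ioi 1) :=
    (integrableOn_Ioi_rpow_of_lt (by linarith) one_pos).const_mul _
  refine (norm_integral_le_of_norm_le hint ?_).trans_eq ?_
  · filter_upwards [ae_restrict_mem measurableSet_Ioi] with x hx
    have hx0 : (0 : ℝ) < x := one_pos.trans hx
    rw [norm_mul, norm_cpow_neg_sub_one hx0, Complex.norm_real, Real.norm_eq_abs,
      show θ - s.re - 1 = θ + (-s.re - 1) by ring, Real.rpow_add hx0, ← mul_assoc]
    gcongr
    exact hAx x (le_of_lt hx)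
  · rw [integral_const_mul, integral_Ioi_rpow_of_lt (by linarith) one_pos, Real.one_rpow]
    have : s.re - θ ≠ 0 := by linarith
    have : θ - s.re - 1 + 1 ≠ 0 := by linarith
    field_simp
    ring

theorem differentiableAt_integral_bR (hfin : ∀ x : ℝ, {g : ℕ →₀ ℕ | bNorm q g ≤ x}.Finite)
    (hAx : ∀ x : ℝ, 1 ≤ x → |bR q κ x| ≤ A * x ^ θ) {s : ℂ} (hs : θ < s.re) :
    DifferentiableAt ℂ
      (fun s : ℂ => ∫ x in Ioi (1 : ℝ), (bR q κ x : ℂ) * (x : ℂ) ^ (-s - 1)) s := by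
  set f : ℝ → ℂ := (Ioi 1).indicator fun x => (bR q κ x : ℂ) with hf
  have hmeas : Measurable f :=
    (Complex.measurable_ofReal.comp (measurable_bR hfin κ)).indicator measurableSet_Ioi
  have hfb : ∀ x : ℝ, 0 < x → ‖f x‖ ≤ A * x ^ θ := by
    intro x hx
    have hA : 0 ≤ A := by
      have := (abs_nonneg _).trans (hAx 1 le_rfl)
      simpa using this
    by_cases h : x ∈ Ioi (1 : ℝ)
    · rw [hf, indicator_of_mem h, Complex.norm_real]
      exact hAx x (le_of_lt h)
    · rw [hf, indicator_of_notMem h, norm_zero]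
      positivity
  have hloc : LocallyIntegrableOn f (Ioi 0) := by
    have hc : LocallyIntegrableOn (fun x : ℝ => A * x ^ θ) (Ioi 0) := by
      refine ContinuousOn.locallyIntegrableOn (fun x hx => ?_) measurableSet_Ioi
      exact (continuousAt_const.mul
        (Real.continuousAt_rpow_const _ _ (Or.inl (ne_of_gt hx)))).continuousWithinAt
    rw [locallyIntegrableOn_iff (isOpen_Ioi.isLocallyClosed)] at hc ⊢
    intro K hK hKc
    refine (hc K hK hKc).mono' hmeas.aestronglyMeasurable ?_
    filter_upwards [ae_restrict_mem hKc.measurableSet] with x hx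
    exact hfb x (hK hx)
  have htop : f =O[atTop] fun x : ℝ => x ^ (-(-θ)) := by
    refine Asymptotics.IsBigO.of_bound A ?_
    filter_upwards [eventually_gt_atTop 0] with x hx
    rw [neg_neg, Real.norm_of_nonneg (Real.rpow_nonneg hx.le _)]
    exact hfb x hx
  have hbot : f =O[𝓝[>] 0] fun x : ℝ => x ^ (-((-s).re - 1)) := by
    refine Asymptotics.IsBigO.of_bound 0 ?_
    filter_upwards [mem_nhdsWithin_of_mem_nhds (Iio_mem_nhds (one_pos (α := ℝ)))] with x hx
    rw [hf, indicator_of_notMem (by simpa using le_of_lt hx)]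
    simp
  have hd := mellin_differentiableAt_of_isBigO_rpow (s := -s) hloc htop (by simpa using hs) hbot
    (by linarith)
  have heq : (fun s : ℂ => ∫ x in Ioi (1 : ℝ), (bR q κ x : ℂ) * (x : ℂ) ^ (-s - 1)) =
      fun s => mellin f (-s) := by
    funext s
    have h1 : ∀ x : ℝ, (x : ℂ) ^ (-s - 1) • f x =
        (Ioi (1 : ℝ)).indicator (fun x => (bR q κ x : ℂ) * (x : ℂ) ^ (-s - 1)) x := by
      intro x
      by_cases h : x ∈ Ioi (1 : ℝ)
      · simp only [hf, indicator_of_mem h, smul_eq_mul, mul_comm]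
      · simp only [hf, indicator_of_notMem h, smul_zero]
    simp only [mellin, h1]
    rw [setIntegral_indicator measurableSet_Ioi,
      inter_eq_self_of_subset_right (Ioi_subset_Ioi zero_le_one)]
  rw [heq]
  exact hd.comp s differentiableAt_id.neg

theorem one_le_norm_bZeta_mul (hq : ∀ i, 1 < q i)
    (hfin : ∀ x : ℝ, {g : ℕ →₀ ℕ | bNorm q g ≤ x}.Finite)
    (hκ : 0 < κ) (hA : 0 < A) (hθ1 : θ < 1)
    (hAx : ∀ x : ℝ, 1 ≤ x → |bR q κ x| ≤ A * x ^ θ) {s : ℂ} (hs : 1 < s.re) :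
    1 ≤ ‖bZeta q κ s‖ * ‖bZeta q κ s.re‖ := by
  have h := one_le_norm_tsum_mul_tsum_norm (u := fun g => (bNorm q g : ℂ) ^ (-s))
    (by simp [bNorm_zero])
    (fun g h => by
      have hpos : ∀ g, 0 ≤ bNorm q g := fun g => zero_le_one.trans (one_le_bNorm hq g)
      rw [bNorm_add, Complex.ofReal_mul, Complex.mul_cpow_ofReal_nonneg (hpos g) (hpos h)])
    (summable_norm_bNorm_cpow hq hfin hκ hA hθ1 hAx hs)
    (fun i => by
      rw [norm_bNorm_cpow hq, bNorm_single]
      exact Real.rpow_lt_one_of_one_lt_of_neg (hq i) (by linarith))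
  rw [bZeta_eq_tsum hq hfin hκ hA hθ1 hAx hs,
    bZeta_eq_tsum hq hfin hκ hA hθ1 hAx (s := (s.re : ℂ)) (by simpa using hs)]
  refine h.trans_eq ?_
  congr 1
  have hterm : ∀ g, (bNorm q g : ℂ) ^ (-(s.re : ℂ)) = ((‖(bNorm q g : ℂ) ^ (-s)‖ : ℝ) : ℂ) := by
    intro g
    rw [norm_bNorm_cpow hq, ← Complex.ofReal_neg,
      ← Complex.ofReal_cpow (zero_le_one.trans (one_le_bNorm hq g))]
  simp only [hterm]
  rw [← Complex.ofReal_tsum, Complex.norm_real,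
    Real.norm_of_nonneg (tsum_nonneg fun g => norm_nonneg _)]

end Beurling

section PoissonKernel

theorem arctan_le_of_nonneg {x : ℝ} (hx : 0 ≤ x) : Real.arctan x ≤ x := by
  have h := Real.le_tan (Real.arctan_nonneg.2 hx) (Real.arctan_lt_pi_div_two x)
  rwa [Real.tan_arctan] at h

theorem le_integral_inv_sq_add_sq {r T H y : ℝ} (hr0 : 0 < r) (hr : r ≤ 2) (hT : 0 ≤ T)
    (hH : 0 < H ^ 2 - T ^ 2 - 4) (hTH : T ≤ H) (hy : |y| ≤ T) :
    (Real.pi - Real.arctan (4 * H / (H ^ 2 - T ^ 2 - 4))) / r ≤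
      ∫ t in (-H)..H, (r ^ 2 + (t - y) ^ 2)⁻¹ := by
  obtain ⟨hy1, hy2⟩ := abs_le.1 hy
  have hTH' : T < H := by nlinarith
  have hyT : y ^ 2 ≤ T ^ 2 := sq_le_sq' hy1 hy2
  rw [intervalIntegral.integral_comp_sub_right (fun t => (r ^ 2 + t ^ 2)⁻¹),
    integral_inv_sq_add_sq hr0.ne', div_eq_inv_mul]
  refine mul_le_mul_of_nonneg_left ?_ (inv_nonneg.2 hr0.le)
  have hu : 0 < (H - y) / r := div_pos (by linarith) hr0
  have huv : 1 < (H - y) / r * ((H + y) / r) := by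
    rw [div_mul_div_comm, lt_div_iff₀ (mul_pos hr0 hr0)]
    nlinarith
  have hneg : Real.arctan ((-H - y) / r) = -Real.arctan ((H + y) / r) := by
    rw [← Real.arctan_neg]
    congr 1
    ring
  rw [hneg, sub_neg_eq_add, Real.arctan_add_eq_add_pi huv hu, add_comm, ← sub_neg_eq_add,
    ← Real.arctan_neg]
  refine sub_le_sub_left (Real.arctan_mono ?_) _
  have hden : 0 < H ^ 2 - y ^ 2 - r ^ 2 := by nlinarith
  have heq : -(((H - y) / r + (H + y) / r) / (1 - (H - y) / r * ((H + y) / r))) =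
      2 * H * r / (H ^ 2 - y ^ 2 - r ^ 2) := by
    have h1 : 1 - (H - y) / r * ((H + y) / r) ≠ 0 := by linarith
    have h2 : 1 - (H - y) / r * ((H + y) / r) = -(H ^ 2 - y ^ 2 - r ^ 2) / r ^ 2 := by
      field_simp
      ring
    rw [h2]
    field_simp
    ring
  rw [heq]
  exact div_le_div₀ (by nlinarith) (by nlinarith) hH (by nlinarith)

theorem integral_majorant_le {H : ℝ} (hH : 0 < H) (C : ℝ) {c : ℝ}
    (hc : H ^ 2 / 3 + 12 + 12 * Real.pi / H ≤ c) :
    ∫ t in (-H)..H, (C + 1 / 2 * (Real.log c - 1) +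
      1 / (2 * c) * (t ^ 2 + 12 + 24 * (1 + t ^ 2)⁻¹)) ≤ 2 * H * (C + 1 / 2 * Real.log c) := by
  have hc0 : 0 < c := lt_of_lt_of_le (by positivity) hc
  have hcont : Continuous fun t : ℝ => (1 + t ^ 2)⁻¹ :=
    (by fun_prop : Continuous fun t : ℝ => 1 + t ^ 2).inv₀ fun t => by positivity
  have hint : ∀ {f : ℝ → ℝ}, Continuous f → IntervalIntegrable f volume (-H) H :=
    fun hf => hf.intervalIntegrable _ _
  rw [intervalIntegral.integral_add (hint (by fun_prop)) (hint (by fun_prop)),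
    intervalIntegral.integral_const, intervalIntegral.integral_const_mul,
    intervalIntegral.integral_add (hint (by fun_prop)) (hint (by fun_prop)),
    intervalIntegral.integral_add (hint (by fun_prop)) (hint (by fun_prop)),
    intervalIntegral.integral_const, intervalIntegral.integral_const_mul,
    integral_inv_one_add_sq, integral_pow, Real.arctan_neg]
  simp only [smul_eq_mul]
  have h1 := (Real.arctan_lt_pi_div_two H).le
  have h2 : H ^ 3 / 3 + 12 * H + 12 * Real.pi ≤ c * H := by
    have h3 := mul_le_mul_of_nonneg_right hc hH.le
    have h4 : 12 * Real.pi / H * H = 12 * Real.pi := by field_simp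
    nlinarith
  have h5 : 1 / (2 * c) * (2 * (c * H)) = H := by field_simp
  have h6 : 1 / (2 * c) * (2 * H ^ 3 / 3 + 24 * H + 48 * Real.arctan H) ≤
      1 / (2 * c) * (2 * (c * H)) := by
    refine mul_le_mul_of_nonneg_left ?_ (by positivity)
    linarith
  rw [h5] at h6
  norm_num
  norm_num at h6
  ring_nf at h6 ⊢
  linarith

theorem log_le_log_add_div_sub_one {c y : ℝ} (hc : 0 < c) (hy : 0 < y) :
    Real.log y ≤ Real.log c + (y / c - 1) := by
  have h := Real.log_le_sub_one_of_pos (div_pos hy hc)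
  rw [Real.log_div hy.ne' hc.ne'] at h
  linarith

theorem card_mul_le_of_forall_sum_le {ι : Type*} (Z : Finset ι) {γ : ι → ℝ} {r T H w C c : ℝ}
    (hr0 : 0 < r) (hr : r ≤ 2) (hT : 0 ≤ T) (hH : 0 < H ^ 2 - T ^ 2 - 4) (hTH : T ≤ H)
    (hw : 0 ≤ w) (hγ : ∀ i ∈ Z, |γ i| ≤ T)
    (hc : H ^ 2 / 3 + 12 + 12 * Real.pi / H ≤ c)
    (hsum : ∀ t : ℝ, ∑ i ∈ Z, w * (r ^ 2 + (t - γ i) ^ 2)⁻¹ ≤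
      C + 1 / 2 * Real.log (t ^ 2 + 12 + 24 * (1 + t ^ 2)⁻¹)) :
    Z.card * (w * ((Real.pi - Real.arctan (4 * H / (H ^ 2 - T ^ 2 - 4))) / r)) ≤
      2 * H * (C + 1 / 2 * Real.log c) := by
  have hH0 : 0 < H := by nlinarith
  have hc0 : 0 < c := lt_of_lt_of_le (by positivity) hc
  have hk : ∀ i, Continuous fun t : ℝ => w * (r ^ 2 + (t - γ i) ^ 2)⁻¹ := fun i =>
    continuous_const.mul ((by fun_prop : Continuous fun t : ℝ => r ^ 2 + (t - γ i) ^ 2).inv₀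
      fun t => by positivity)
  have hcont : Continuous fun t : ℝ => (1 + t ^ 2)⁻¹ :=
    (by fun_prop : Continuous fun t : ℝ => 1 + t ^ 2).inv₀ fun t => by positivity
  calc Z.card * (w * ((Real.pi - Real.arctan (4 * H / (H ^ 2 - T ^ 2 - 4))) / r))
      = ∑ i ∈ Z, w * ((Real.pi - Real.arctan (4 * H / (H ^ 2 - T ^ 2 - 4))) / r) := by
        rw [Finset.sum_const, nsmul_eq_mul]
    _ ≤ ∑ i ∈ Z, ∫ t in (-H)..H, w * (r ^ 2 + (t - γ i) ^ 2)⁻¹ := by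
        refine Finset.sum_le_sum fun i hi => ?_
        rw [intervalIntegral.integral_const_mul]
        exact mul_le_mul_of_nonneg_left
          (le_integral_inv_sq_add_sq hr0 hr hT hH hTH (hγ i hi)) hw
    _ = ∫ t in (-H)..H, ∑ i ∈ Z, w * (r ^ 2 + (t - γ i) ^ 2)⁻¹ :=
        (intervalIntegral.integral_finsetSum fun i _ => (hk i).intervalIntegrable _ _).symm
    _ ≤ ∫ t in (-H)..H, (C + 1 / 2 * (Real.log c - 1) +
          1 / (2 * c) * (t ^ 2 + 12 + 24 * (1 + t ^ 2)⁻¹)) := by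
        refine intervalIntegral.integral_mono_on (by linarith)
          ((continuous_finsetSum _ fun i _ => hk i).intervalIntegrable _ _)
          (Continuous.intervalIntegrable (by fun_prop) _ _) fun t _ => (hsum t).trans ?_
        have h := log_le_log_add_div_sub_one hc0
          (by positivity : 0 < t ^ 2 + 12 + 24 * (1 + t ^ 2)⁻¹)
        have h2 : 1 / (2 * c) * (t ^ 2 + 12 + 24 * (1 + t ^ 2)⁻¹) =
            1 / 2 * ((t ^ 2 + 12 + 24 * (1 + t ^ 2)⁻¹) / c) := by
          ring
        rw [h2]
        linarith
    _ ≤ _ := integral_majorant_le hH0 C hc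

end PoissonKernel

section Numerics

theorem log_ten_le : Real.log 10 ≤ 10 / 3 * Real.log 2 := by
  have h : Real.log (10 ^ 3) ≤ Real.log (2 ^ 10) := Real.log_le_log (by norm_num) (by norm_num)
  rw [Real.log_pow, Real.log_pow] at h
  push_cast at h
  linarith

theorem two_le_pi_sub_arctan_two : 2 ≤ Real.pi - Real.arctan 2 := by
  have h1 : Real.arctan (1 / 2) + Real.arctan (1 / 3) = Real.pi / 4 := by
    rw [Real.arctan_add (by norm_num), ← Real.arctan_one]
    norm_num
  have h2 := Real.arctan_inv_of_pos (x := 2) (by norm_num)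
  rw [← one_div] at h2
  have h3 := arctan_le_of_nonneg (x := 1 / 3) (by norm_num)
  linarith [Real.pi_gt_d2]

/-- The elementary inequality comparing the contour height `11T/10 + 1` with `T`. -/
theorem height_mul_log_le {T : ℝ} (hT : 5 ≤ T) {E : ℝ} (hE : 0 ≤ E) :
    (11 / 10 * T + 1) * (171 / 125) * (E + Real.log 10 +
      1 / 2 * Real.log ((11 / 10 * T + 1) ^ 2 / 3 + 891 / 50)) ≤
    (Real.pi - Real.arctan (4 * (11 / 10 * T + 1) / ((11 / 10 * T + 1) ^ 2 - T ^ 2 - 4))) *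
      (T * (E + 3 + 1 / 2 * Real.log T)) := by
  set S := Real.pi - Real.arctan (4 * (11 / 10 * T + 1) / ((11 / 10 * T + 1) ^ 2 - T ^ 2 - 4))
  have hT0 : 0 < T := by linarith
  have hden : 0 < (11 / 10 * T + 1) ^ 2 - T ^ 2 - 4 := by nlinarith
  have hS2 : 2 ≤ S := by
    refine two_le_pi_sub_arctan_two.trans (sub_le_sub_left (Real.arctan_mono ?_) _)
    rw [div_le_iff₀ hden]
    nlinarith
  have hL2 := Real.log_two_lt_d9
  have hL2' := Real.log_two_gt_d9
  have hL10 := log_ten_le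
  have hL0 : 0 ≤ Real.log T := Real.log_nonneg (by linarith)
  have hlog : ∀ c' : ℝ, 0 < c' → (11 / 10 * T + 1) ^ 2 / 3 + 891 / 50 ≤ c' * T ^ 2 →
      Real.log ((11 / 10 * T + 1) ^ 2 / 3 + 891 / 50) ≤ Real.log c' + 2 * Real.log T := by
    intro c' hc' h
    refine (Real.log_le_log (by positivity) h).trans_eq ?_
    rw [Real.log_mul hc'.ne' (by positivity), Real.log_pow]
    norm_num
  have hpow : ∀ n : ℕ, T ≤ 2 ^ n → Real.log T ≤ n * Real.log 2 := by
    intro n h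
    rw [← Real.log_pow]
    exact Real.log_le_log hT0 h
  have key : ∀ α β : ℝ, (11 / 10 * T + 1) * (171 / 125) ≤ α * T → α ≤ S →
      1 / 2 * Real.log ((11 / 10 * T + 1) ^ 2 / 3 + 891 / 50) ≤ β + Real.log T →
      0 ≤ Real.log 10 + (β + Real.log T) →
      α * (Real.log 10 + (β + Real.log T)) ≤ S * (3 + 1 / 2 * Real.log T) →
      (11 / 10 * T + 1) * (171 / 125) * (E + Real.log 10 +
        1 / 2 * Real.log ((11 / 10 * T + 1) ^ 2 / 3 + 891 / 50)) ≤
      S * (T * (E + 3 + 1 / 2 * Real.log T)) := by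
    intro α β hα hαS hβ h0 h
    calc _ ≤ (11 / 10 * T + 1) * (171 / 125) * (E + (Real.log 10 + (β + Real.log T))) := by
          refine mul_le_mul_of_nonneg_left (by linarith) (by positivity)
      _ ≤ α * T * (E + (Real.log 10 + (β + Real.log T))) :=
          mul_le_mul_of_nonneg_right hα (by linarith)
      _ = T * (α * E + α * (Real.log 10 + (β + Real.log T))) := by ring
      _ ≤ T * (S * E + S * (3 + 1 / 2 * Real.log T)) := by gcongr
      _ = _ := by ring
  have hl10 : 1 ≤ Real.log 10 := by
    have : Real.log (2 ^ 2) ≤ Real.log 10 := Real.log_le_log (by norm_num) (by norm_num)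
    rw [Real.log_pow] at this
    push_cast at this
    linarith
  have hfin : ∀ x y : ℝ, x ≤ 2 * y → 0 ≤ y → x ≤ S * y := fun x y h hy =>
    h.trans (mul_le_mul_of_nonneg_right hS2 hy)
  have hy : 0 ≤ 3 + 1 / 2 * Real.log T := by linarith
  rcases le_total T (2 ^ 3) with h8 | h8
  · have hc := hlog 1.28 (by norm_num) (by nlinarith)
    have hb := Real.log_le_sub_one_of_pos (show (0 : ℝ) < 1.28 by norm_num)
    have hL := hpow 3 h8
    push_cast at hL
    refine key 1.7784 0.14 (by linarith) (by linarith) (by linarith) (by linarith)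
      (hfin _ _ (by linarith) hy)
  rcases le_total T (2 ^ 4) with h16 | h16
  · have hc := hlog 1 (by norm_num) (by nlinarith)
    rw [Real.log_one] at hc
    have hL := hpow 4 h16
    push_cast at hL
    refine key 1.6759 0 (by linarith) (by linarith) (by linarith) (by linarith)
      (hfin _ _ (by linarith) hy)
  rcases le_total T (2 ^ 6) with h64 | h64
  · have hc := hlog 0.521 (by norm_num) (by nlinarith)
    have hb := Real.log_le_sub_one_of_pos (show (0 : ℝ) < 0.521 by norm_num)
    have hL := hpow 6 h64
    push_cast at hL
    refine key 1.5904 (-0.239) (by linarith) (by linarith) (by linarith) (by linarith)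
      (hfin _ _ (by linarith) hy)
  have hc := hlog 2⁻¹ (by norm_num) (by nlinarith)
  rw [Real.log_inv] at hc
  rcases le_total T (2 ^ 8) with h256 | h256
  · have hL := hpow 8 h256
    push_cast at hL
    refine key 1.5264 (-0.346) (by linarith) (by linarith) (by linarith) (by linarith)
      (hfin _ _ (by linarith) hy)
  · have hS3 : 3.04 ≤ S := by
      have h1 : 4 * (11 / 10 * T + 1) / ((11 / 10 * T + 1) ^ 2 - T ^ 2 - 4) ≤ 0.1 := by
        rw [div_le_iff₀ hden]
        nlinarith
      have h2 := arctan_le_of_nonneg (x := 4 * (11 / 10 * T + 1) /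
        ((11 / 10 * T + 1) ^ 2 - T ^ 2 - 4)) (by positivity)
      linarith [Real.pi_gt_d2]
    refine key 1.52 0 (by linarith) (by linarith) (by linarith) (by linarith) ?_
    nlinarith

end Numerics

section ZeroCounting

variable {q : ℕ → ℝ} {κ A θ : ℝ}

/-- The regularized zeta function `(s - 1) ζ(s)`, which is holomorphic on `Re s > θ`. -/
noncomputable def bXi (q : ℕ → ℝ) (κ : ℝ) (s : ℂ) : ℂ :=
  κ + s * (s - 1) * ∫ x in Ioi (1 : ℝ), (bR q κ x : ℂ) * (x : ℂ) ^ (-s - 1)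

theorem bXi_eq {s : ℂ} (hs : s ≠ 1) : bXi q κ s = (s - 1) * bZeta q κ s := by
  have := sub_ne_zero.2 hs
  rw [bXi, bZeta]
  field_simp

theorem norm_bXi_le (hκ : 0 < κ) (hA : 0 < A)
    (hAx : ∀ x : ℝ, 1 ≤ x → |bR q κ x| ≤ A * x ^ θ) {d : ℝ} (hd0 : 0 < d) (hθ : 0 ≤ θ) {s : ℂ}
    (hs : θ + d < s.re) :
    ‖bXi q κ s‖ ≤ (A + κ) * (‖s‖ * ‖s + 1‖) / d := by
  have hI := (norm_integral_bR_le hAx (by linarith : θ < s.re)).trans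
    (div_le_div_of_nonneg_left hA.le hd0 (by linarith : d ≤ s.re - θ))
  have hsd : d ≤ ‖s‖ := by
    have := Complex.re_le_norm s
    linarith
  have hs1 : 1 ≤ ‖s + 1‖ := by
    have := Complex.re_le_norm (s + 1)
    simp at this
    linarith
  have hs2 : ‖s - 1‖ ≤ ‖s + 1‖ := by
    rw [Complex.norm_def, Complex.norm_def]
    refine Real.sqrt_le_sqrt ?_
    simp only [Complex.normSq_apply, Complex.sub_re, Complex.sub_im, Complex.add_re,
      Complex.add_im, Complex.one_re, Complex.one_im]
    nlinarith
  calc ‖bXi q κ s‖ ≤ κ + ‖s‖ * ‖s - 1‖ * (A / d) := by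
        refine (norm_add_le _ _).trans ?_
        rw [Complex.norm_real, Real.norm_of_nonneg hκ.le, norm_mul, norm_mul]
        gcongr
    _ ≤ κ * ((‖s‖ * ‖s + 1‖) / d) + ‖s‖ * ‖s + 1‖ * (A / d) := by
        gcongr
        refine le_mul_of_one_le_right hκ.le ?_
        rw [one_le_div hd0]
        nlinarith
    _ = _ := by ring

theorem norm_bZeta_two_le (hκ : 0 < κ) (hA : 0 < A) (hθ1 : θ < 1)
    (hAx : ∀ x : ℝ, 1 ≤ x → |bR q κ x| ≤ A * x ^ θ) : ‖bZeta q κ 2‖ ≤ 2 * (A + κ) := by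
  have hI := (norm_integral_bR_le hAx (s := 2) (by simp; linarith)).trans
    (div_le_self hA.le (by simp; linarith))
  rw [bZeta]
  refine (norm_add_le _ _).trans ?_
  rw [norm_mul, show (2 : ℂ) - 1 = 1 by norm_num, div_one, Complex.norm_real,
    Real.norm_of_nonneg hκ.le, Complex.norm_ofNat]
  linarith

theorem sum_halfPlane_le (hq : ∀ i, 1 < q i)
    (hfin : ∀ x : ℝ, {g : ℕ →₀ ℕ | bNorm q g ≤ x}.Finite)
    (hκ : 0 < κ) (hA : 0 < A) (hθ0 : 0 < θ) (hθ1 : θ < 1)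
    (hAx : ∀ x : ℝ, 1 ≤ x → |bR q κ x| ≤ A * x ^ θ) {d x : ℝ} (hd0 : 0 < d) (hd1 : d ≤ 1)
    (hx : 0 < x) (Z : Finset ℂ) (hZ : ∀ ρ ∈ Z, ρ ≠ 1 ∧ θ + d + x ≤ ρ.re ∧ bZeta q κ ρ = 0) (t : ℝ) :
    ∑ ρ ∈ Z, 2 * (2 - (θ + d)) * x * ((2 - (θ + d)) ^ 2 + x ^ 2 + (t - ρ.im) ^ 2)⁻¹ ≤
      2 * Real.log (A + κ) + Real.log (2 / d) +
        1 / 2 * Real.log (t ^ 2 + 12 + 24 * (1 + t ^ 2)⁻¹) := by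
  set s : ℂ := ((2 : ℝ) : ℂ) + t * Complex.I with hsdef
  have hsre : s.re = 2 := by simp [hsdef]
  have hsim : s.im = t := by simp [hsdef]
  have hne : ∀ {z : ℂ}, 1 < z.re → bZeta q κ z ≠ 0 := fun {z} hz h0 => by
    have := one_le_norm_bZeta_mul hq hfin hκ hA hθ1 hAx hz
    rw [h0, norm_zero, zero_mul] at this
    linarith
  have hs1 : s ≠ 1 := fun h => by
    rw [h] at hsre
    norm_num at hsre
  have hζs : bZeta q κ s ≠ 0 := hne (by rw [hsre]; norm_num)
  have hAκ : 0 < A + κ := by linarith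
  set f : ℂ → ℂ := fun z => bXi q κ z * (d / ((A + κ) * (z * (z + 1))) : ℂ) with hfdef
  have hz0 : ∀ z : ℂ, θ + d < z.re → z ≠ 0 ∧ z + 1 ≠ 0 := by
    intro z hz
    constructor <;> intro h <;> have := congrArg Complex.re h <;> simp at this <;> linarith
  have hAκC : (A + κ : ℂ) ≠ 0 := by exact_mod_cast hAκ.ne'
  have hnormf : ∀ z : ℂ, ‖f z‖ = ‖bXi q κ z‖ * (d / ((A + κ) * (‖z‖ * ‖z + 1‖))) := by
    intro z
    rw [hfdef]
    simp only [norm_mul, norm_div]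
    rw [← Complex.ofReal_add, Complex.norm_real, Complex.norm_real, Real.norm_of_nonneg hd0.le,
      Real.norm_of_nonneg hAκ.le]
  have hfd : DifferentiableOn ℂ f {z | θ + d < z.re} := by
    intro z hz
    obtain ⟨h0, h1⟩ := hz0 z hz
    have hI := differentiableAt_integral_bR hfin hAx (s := z) (by
      have : θ + d < z.re := hz
      linarith)
    refine DifferentiableAt.differentiableWithinAt ?_
    refine DifferentiableAt.mul (((differentiableAt_const _).add
      ((by fun_prop : DifferentiableAt ℂ (fun z : ℂ => z * (z - 1)) z).mul hI))) ?_
    exact (differentiableAt_const _).div (by fun_prop) (mul_ne_zero hAκC (mul_ne_zero h0 h1))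
  have hf1 : ∀ z : ℂ, θ + d < z.re → ‖f z‖ ≤ 1 := by
    intro z hz
    obtain ⟨h0, h1⟩ := hz0 z hz
    have h0' := norm_pos_iff.2 h0
    have h1' := norm_pos_iff.2 h1
    rw [hnormf]
    refine (mul_le_mul_of_nonneg_right (norm_bXi_le hκ hA hAx hd0 hθ0.le hz)
      (by positivity)).trans_eq ?_
    field_simp
  have hf0 : ∀ ρ ∈ Z, f ρ = 0 := by
    intro ρ hρ
    obtain ⟨h1, _, h0⟩ := hZ ρ hρ
    simp only [hfdef]
    rw [bXi_eq h1, h0, mul_zero, zero_mul]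
  have hsa : θ + d < s.re := by rw [hsre]; linarith
  have hprod := norm_le_prod_norm_halfPlaneFactor Z
    (fun ρ hρ => by linarith [(hZ ρ hρ).2.1]) hfd hf1 hf0 hsa
  have hζ2 : 1 ≤ ‖bZeta q κ s‖ * (2 * (A + κ)) := by
    have h1 := one_le_norm_bZeta_mul hq hfin hκ hA hθ1 hAx (s := s) (by rw [hsre]; norm_num)
    rw [hsre] at h1
    exact h1.trans (mul_le_mul_of_nonneg_left
      (by simpa using norm_bZeta_two_le hκ hA hθ1 hAx) (norm_nonneg _))
  have hfs : 0 < ‖f s‖ := by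
    obtain ⟨h0, h1⟩ := hz0 s hsa
    have h0' := norm_pos_iff.2 h0
    have h1' := norm_pos_iff.2 h1
    rw [hnormf, bXi_eq hs1, norm_mul]
    have h2 := norm_pos_iff.2 (sub_ne_zero.2 hs1)
    have h3 := norm_pos_iff.2 hζs
    positivity
  have hlog : -Real.log ‖f s‖ ≤ 2 * Real.log (A + κ) + Real.log (2 / d) +
      1 / 2 * Real.log (t ^ 2 + 12 + 24 * (1 + t ^ 2)⁻¹) := by
    have hy : t ^ 2 + 12 + 24 * (1 + t ^ 2)⁻¹ =
        (t ^ 2 + 4) * (t ^ 2 + 9) / (1 + t ^ 2) := by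
      field_simp
      ring
    have hn1 : ‖s - 1‖ = √(1 + t ^ 2) := by
      rw [Complex.norm_def, Complex.normSq_apply]
      simp only [Complex.sub_re, Complex.sub_im, hsre, hsim, Complex.one_re, Complex.one_im]
      congr 1
      ring
    have hn2 : ‖s‖ = √(t ^ 2 + 4) := by
      rw [Complex.norm_def, Complex.normSq_apply, hsre, hsim]
      congr 1
      ring
    have hn3 : ‖s + 1‖ = √(t ^ 2 + 9) := by
      rw [Complex.norm_def, Complex.normSq_apply]
      simp only [Complex.add_re, Complex.add_im, hsre, hsim, Complex.one_re, Complex.one_im]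
      congr 1
      ring
    have hsq : 1 / 2 * Real.log (t ^ 2 + 12 + 24 * (1 + t ^ 2)⁻¹) =
        Real.log (‖s‖ * ‖s + 1‖ / ‖s - 1‖) := by
      rw [hn1, hn2, hn3, hy, ← Real.sqrt_mul (by positivity), ← Real.sqrt_div (by positivity),
        Real.log_sqrt (by positivity)]
      ring
    have p1 : 0 < ‖s - 1‖ := by rw [hn1]; positivity
    have p2 : 0 < ‖s‖ := by rw [hn2]; positivity
    have p3 : 0 < ‖s + 1‖ := by rw [hn3]; positivity
    have hpow : 2 * Real.log (A + κ) = Real.log ((A + κ) ^ 2) := by simp [Real.log_pow]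
    rw [hsq, hpow, ← Real.log_mul (by positivity) (by positivity),
      ← Real.log_mul (by positivity) (by positivity), ← Real.log_inv]
    refine Real.log_le_log (inv_pos.2 hfs) ?_
    rw [inv_le_iff_one_le_mul₀ hfs, hnormf, bXi_eq hs1, norm_mul]
    refine hζ2.trans_eq ?_
    field_simp
  calc ∑ ρ ∈ Z, 2 * (2 - (θ + d)) * x * ((2 - (θ + d)) ^ 2 + x ^ 2 + (t - ρ.im) ^ 2)⁻¹
      ≤ ∑ ρ ∈ Z, -Real.log ‖halfPlaneFactor (θ + d) ρ s‖ := by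
        refine Finset.sum_le_sum fun ρ hρ => ?_
        obtain ⟨_, hre, h0⟩ := hZ ρ hρ
        rw [← div_eq_mul_inv]
        refine le_neg_log_norm_halfPlaneFactor hre hx ?_ ?_
        · by_contra! h
          exact hne (by linarith) h0
        · rintro rfl
          exact hζs h0
    _ = -Real.log (∏ ρ ∈ Z, ‖halfPlaneFactor (θ + d) ρ s‖) := by
        rw [Real.log_prod fun ρ hρ h => ?_, Finset.sum_neg_distrib]
        rw [Finset.prod_eq_zero hρ h] at hprod
        linarith
    _ ≤ -Real.log ‖f s‖ := neg_le_neg (Real.log_le_log hfs hprod)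
    _ ≤ _ := hlog

theorem card_zeros_le (hq : ∀ i, 1 < q i)
    (hfin : ∀ x : ℝ, {g : ℕ →₀ ℕ | bNorm q g ≤ x}.Finite)
    (hκ : 0 < κ) (hA : 0 < A) (hθ0 : 0 < θ) (hθ1 : θ < 1)
    (hAx : ∀ x : ℝ, 1 ≤ x → |bR q κ x| ≤ A * x ^ θ) (hAκ : 1 ≤ A + κ) {b T : ℝ}
    (hb : θ < b) (hb1 : b < 1) (hT : 5 ≤ T) (Z : Finset ℂ)
    (hZ : ∀ ρ ∈ Z, ρ ≠ 1 ∧ b ≤ ρ.re ∧ |ρ.im| ≤ T ∧ bZeta q κ ρ = 0) :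
    (Z.card : ℝ) ≤ 1 / (b - θ) *
      (1 / 2 * T * Real.log T + (2 * Real.log (A + κ) + Real.log (1 / (b - θ)) + 3) * T) := by
  set D := b - θ with hD
  have hD0 : 0 < D := sub_pos.2 hb
  have hD1 : D < 1 := by linarith
  set p := 2 - (θ + D / 5) with hp
  have hp0 : 0 < p := by linarith
  set r := √(p ^ 2 + (4 / 5 * D) ^ 2) with hr
  have hr2 : r ^ 2 = p ^ 2 + (4 / 5 * D) ^ 2 := Real.sq_sqrt (by positivity)
  have hr0 : 0 < r := Real.sqrt_pos.2 (by positivity)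
  have hrle : r ≤ 2 := by
    refine abs_le_of_sq_le_sq' ?_ zero_le_two |>.2
    rw [hr2]
    nlinarith
  have hrp : 5 / 4 * r ≤ 171 / 125 * p := by
    refine abs_le_of_sq_le_sq' ?_ (by positivity) |>.2
    have : 4 / 5 * D ≤ 4 / 9 * p := by linarith
    rw [mul_pow, hr2]
    nlinarith
  set E := 2 * Real.log (A + κ) + Real.log (1 / D) with hE
  have hE0 : 0 ≤ E := add_nonneg (mul_nonneg zero_le_two (Real.log_nonneg hAκ))
    (Real.log_nonneg (by rw [le_div_iff₀ hD0]; linarith))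
  have hlogd : 2 * Real.log (A + κ) + Real.log (2 / (D / 5)) = E + Real.log 10 := by
    rw [hE, add_assoc, ← Real.log_mul (by positivity) (by positivity)]
    congr 2
    field_simp
    norm_num
  set H := 11 / 10 * T + 1 with hH
  have hc : H ^ 2 / 3 + 12 + 12 * Real.pi / H ≤ H ^ 2 / 3 + 891 / 50 := by
    have : 12 * Real.pi / H ≤ 291 / 50 := by
      rw [div_le_iff₀ (by linarith)]
      linarith [Real.pi_lt_d2]
    linarith
  have hcard := card_mul_le_of_forall_sum_le Z (γ := Complex.im) (r := r) (T := T) (H := H)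
    (w := 2 * p * (4 / 5 * D)) (C := E + Real.log 10) (c := H ^ 2 / 3 + 891 / 50)
    hr0 hrle (by linarith) (by nlinarith) (by linarith) (by positivity)
    (fun ρ hρ => (hZ ρ hρ).2.2.1) hc (fun t => by
      rw [← hlogd, hr2]
      refine sum_halfPlane_le hq hfin hκ hA hθ0 hθ1 hAx (by linarith) (by linarith)
        (by positivity) Z (fun ρ hρ => ?_) t
      obtain ⟨h1, h2, _, h3⟩ := hZ ρ hρ
      exact ⟨h1, by linarith, h3⟩)
  have hnum := height_mul_log_le hT hE0
  rw [← hH] at hnum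
  set S := Real.pi - Real.arctan (4 * H / (H ^ 2 - T ^ 2 - 4)) with hS
  set L := E + Real.log 10 + 1 / 2 * Real.log (H ^ 2 / 3 + 891 / 50) with hL
  have hS0 : 0 < S := by
    linarith [Real.arctan_lt_pi_div_two (4 * H / (H ^ 2 - T ^ 2 - 4)), Real.pi_pos]
  have hL0 : 0 ≤ L := add_nonneg (add_nonneg hE0 (Real.log_nonneg (by norm_num)))
    (mul_nonneg (by norm_num) (Real.log_nonneg (by nlinarith)))
  have hmain : (Z.card * D) * (S * p) ≤ (T * (E + 3 + 1 / 2 * Real.log T)) * (S * p) := by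
    calc (Z.card * D) * (S * p)
        = 5 / 8 * r * (Z.card * (2 * p * (4 / 5 * D) * (S / r))) := by
          field_simp
          ring
      _ ≤ 5 / 8 * r * (2 * H * L) := mul_le_mul_of_nonneg_left hcard (by positivity)
      _ = 5 / 4 * r * (H * L) := by ring
      _ ≤ 171 / 125 * p * (H * L) :=
          mul_le_mul_of_nonneg_right hrp (mul_nonneg (by linarith) hL0)
      _ = H * (171 / 125) * L * p := by ring
      _ ≤ S * (T * (E + 3 + 1 / 2 * Real.log T)) * p :=
          mul_le_mul_of_nonneg_right hnum hp0.le
      _ = _ := by ring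
  have := le_of_mul_le_mul_right hmain (mul_pos hS0 hp0)
  rw [one_div_mul_eq_div, le_div_iff₀ hD0]
  refine this.trans_eq ?_
  ring

end ZeroCounting

end ZeroDensity

theorem statement_13
    (q : ℕ → ℝ) (hq : ∀ i, 1 < q i)
    (hfin : ∀ x : ℝ, {g : ℕ →₀ ℕ | bNorm q g ≤ x}.Finite)
    (κ A θ : ℝ) (hκ : 0 < κ) (hA : 0 < A) (hθ0 : 0 < θ) (hθ1 : θ < 1)
    (hAxiomA : ∀ x : ℝ, 1 ≤ x → |bR q κ x| ≤ A * x ^ θ)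
    (hAκ : 1 ≤ A + κ) (b T : ℝ) (hb : θ < b) (hb1 : b < 1) (hT : 5 ≤ T) :
    {ρ : ℂ | ρ ≠ 1 ∧ b ≤ ρ.re ∧ |ρ.im| ≤ T ∧ bZeta q κ ρ = 0}.Finite ∧
    ({ρ : ℂ | ρ ≠ 1 ∧ b ≤ ρ.re ∧ |ρ.im| ≤ T ∧ bZeta q κ ρ = 0}.ncard : ℝ) ≤
      1 / (b - θ) *
        (1 / 2 * T * Real.log T + (2 * Real.log (A + κ) + Real.log (1 / (b - θ)) + 3) * T) := by
  have hcard := fun (Z : Finset ℂ) hZ =>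
    card_zeros_le hq hfin hκ hA hθ0 hθ1 hAxiomA hAκ hb hb1 hT Z hZ
  have hfinite : {ρ : ℂ | ρ ≠ 1 ∧ b ≤ ρ.re ∧ |ρ.im| ≤ T ∧ bZeta q κ ρ = 0}.Finite := by
    by_contra hinf
    obtain ⟨n, hn⟩ := exists_nat_gt (1 / (b - θ) *
      (1 / 2 * T * Real.log T + (2 * Real.log (A + κ) + Real.log (1 / (b - θ)) + 3) * T))
    obtain ⟨Z, hZ, rfl⟩ := Set.Infinite.exists_subset_card_eq hinf n
    exact hn.not_ge (hcard Z fun ρ hρ => hZ hρ)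
  refine ⟨hfinite, ?_⟩
  rw [Set.ncard_eq_toFinset_card _ hfinite]
  exact hcard _ fun ρ hρ => hfinite.mem_toFinset.1 hρ
end

section
/- Assume A + κ ≥ 1, let θ < b < 1 and T > R ≥ 5. Then the set Z(b;R,T) of zeros of ζ with real part at least b and imaginary part of absolute value between R and T is finite, and #Z(b;R,T) ≤ (1/(b−θ))·( (4/(3π))·(T−R)·log( 11.4·(A+κ)²·T/(b−θ) ) + (16/3)·log( 60·(A+κ)²·T/(b−θ) ) ). -/
open scoped BigOperators Real

/-! ### A Jensen-type inequality for bounded analytic functions in a vertical strip -/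

theorem Complex.norm_sin_sq (z : ℂ) :
    ‖Complex.sin z‖ ^ 2 = (Real.cosh (2 * z.im) - Real.cos (2 * z.re)) / 2 := by
  have hre : (Complex.sin z).re = Real.sin z.re * Real.cosh z.im := by
    rw [Complex.sin_eq]; simp [Complex.sin_ofReal_re, Complex.cosh_ofReal_re]
  have him : (Complex.sin z).im = Real.cos z.re * Real.sinh z.im := by
    rw [Complex.sin_eq]; simp [Complex.cos_ofReal_re, Complex.sinh_ofReal_re]
  rw [Complex.sq_norm, Complex.normSq_apply, hre, him, Real.cosh_two_mul, Real.cos_two_mul]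
  have h1 := Real.sin_sq_add_cos_sq z.re
  have h2 := Real.cosh_sq z.im
  linear_combination (Real.cosh z.im ^ 2) * h1 + (1/2 - Real.cos z.re ^ 2) * h2

/-- Numerator of the conformal Blaschke factor with zero `ρ` of the strip of half-width `P`. -/
noncomputable def stripNum (P : ℝ) (ρ s : ℂ) : ℂ :=
  Complex.sin ((π / (4 * P) : ℝ) * (s - ρ))

/-- Denominator of the conformal Blaschke factor of the strip `l < re < l + 2P`. -/
noncomputable def stripDen (l P : ℝ) (ρ s : ℂ) : ℂ :=
  Complex.sin ((π / (4 * P) : ℝ) * (s + (starRingEnd ℂ) ρ - 2 * l))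

theorem norm_stripNum_sq (P : ℝ) (ρ s : ℂ) :
    ‖stripNum P ρ s‖ ^ 2 = (Real.cosh (π / (2 * P) * (s.im - ρ.im)) -
      Real.cos (π / (2 * P) * (s.re - ρ.re))) / 2 := by
  rw [stripNum, Complex.norm_sin_sq, Complex.re_ofReal_mul, Complex.im_ofReal_mul,
    Complex.sub_re, Complex.sub_im]
  congr 3 <;> ring

theorem norm_stripDen_sq (l P : ℝ) (ρ s : ℂ) :
    ‖stripDen l P ρ s‖ ^ 2 = (Real.cosh (π / (2 * P) * (s.im - ρ.im)) -
      Real.cos (π / (2 * P) * (s.re + ρ.re - 2 * l))) / 2 := by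
  rw [stripDen, Complex.norm_sin_sq, Complex.re_ofReal_mul, Complex.im_ofReal_mul]
  simp only [Complex.sub_re, Complex.sub_im, Complex.add_re, Complex.add_im, Complex.conj_re,
    Complex.conj_im, Complex.mul_re, Complex.mul_im, Complex.re_ofNat, Complex.im_ofNat,
    Complex.ofReal_re, Complex.ofReal_im]
  congr 3 <;> ring

theorem norm_stripNum_eq_left {l P : ℝ} {ρ s : ℂ} (hs : s.re = l) :
    ‖stripNum P ρ s‖ = ‖stripDen l P ρ s‖ := by
  rw [← sq_eq_sq₀ (norm_nonneg _) (norm_nonneg _), norm_stripNum_sq, norm_stripDen_sq, hs]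
  congr 2
  rw [← Real.cos_neg]
  congr 1
  ring

theorem norm_stripNum_eq_right {l P : ℝ} (hP : 0 < P) {ρ s : ℂ} (hs : s.re = l + 2 * P) :
    ‖stripNum P ρ s‖ = ‖stripDen l P ρ s‖ := by
  rw [← sq_eq_sq₀ (norm_nonneg _) (norm_nonneg _), norm_stripNum_sq, norm_stripDen_sq, hs]
  congr 2
  have h1 : π / (2 * P) * (l + 2 * P - ρ.re) = π - π / (2 * P) * (ρ.re - l) := by
    field_simp; ring
  have h2 : π / (2 * P) * (l + 2 * P + ρ.re - 2 * l) = π / (2 * P) * (ρ.re - l) + π := by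
    field_simp; ring
  rw [h1, h2, Real.cos_pi_sub, Real.cos_add_pi]

theorem norm_stripNum_sq_center {l P : ℝ} (hP : 0 < P) {ρ s : ℂ} (hs : s.re = l + P) :
    ‖stripNum P ρ s‖ ^ 2 = (Real.cosh (π / (2 * P) * (s.im - ρ.im)) -
      Real.sin (π / (2 * P) * (ρ.re - l))) / 2 := by
  rw [norm_stripNum_sq, hs]
  congr 2
  rw [← Real.cos_pi_div_two_sub]
  congr 1
  field_simp; ring

theorem norm_stripDen_sq_center {l P : ℝ} (hP : 0 < P) {ρ s : ℂ} (hs : s.re = l + P) :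
    ‖stripDen l P ρ s‖ ^ 2 = (Real.cosh (π / (2 * P) * (s.im - ρ.im)) +
      Real.sin (π / (2 * P) * (ρ.re - l))) / 2 := by
  rw [norm_stripDen_sq, hs, ← Real.cos_sub_pi_div_two]
  have h : π / (2 * P) * (l + P + ρ.re - 2 * l) = π / (2 * P) * (ρ.re - l) - π / 2 + π := by
    field_simp; ring
  rw [h, Real.cos_add_pi]
  ring

theorem stripNum_ne_zero {P : ℝ} (hP : 0 < P) {ρ s : ℂ} (h : |s.re - ρ.re| < 2 * P)
    (hne : s ≠ ρ) : stripNum P ρ s ≠ 0 := by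
  intro h0
  have hsq := norm_stripNum_sq P ρ s
  rw [h0, norm_zero] at hsq
  set x := π / (2 * P) * (s.re - ρ.re) with hx
  set y := π / (2 * P) * (s.im - ρ.im) with hy
  have hu : 0 < π / (2 * P) := by positivity
  have h1 := Real.one_le_cosh y
  have h2 := Real.cos_le_one x
  have hc : Real.cosh y = 1 := by linarith
  have hx1 : Real.cos x = 1 := by linarith
  have hy0 : y = 0 := by
    by_contra hne
    exact absurd hc (Real.one_lt_cosh.2 hne).ne'
  have hxlt : |x| < π := by
    rw [hx, abs_mul, abs_of_pos hu]
    calc π / (2 * P) * |s.re - ρ.re| < π / (2 * P) * (2 * P) := by gcongr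
      _ = π := by field_simp
  have hx0 : x = 0 :=
    (Real.cos_eq_one_iff_of_lt_of_lt (by linarith [(abs_lt.1 hxlt).1, Real.pi_pos])
      (by linarith [(abs_lt.1 hxlt).2, Real.pi_pos])).1 hx1
  apply hne
  apply Complex.ext
  · have := (mul_eq_zero.1 (hx ▸ hx0)).resolve_left hu.ne'
    linarith
  · have := (mul_eq_zero.1 (hy ▸ hy0)).resolve_left hu.ne'
    linarith

theorem differentiable_stripNum (P : ℝ) (ρ : ℂ) : Differentiable ℂ (stripNum P ρ) := by
  unfold stripNum; fun_prop

theorem differentiable_stripDen (l P : ℝ) (ρ : ℂ) : Differentiable ℂ (stripDen l P ρ) := by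
  unfold stripDen; fun_prop

theorem stripNum_self (P : ℝ) (ρ : ℂ) : stripNum P ρ ρ = 0 := by simp [stripNum]

theorem dslope_stripNum_ne_zero {P : ℝ} (hP : 0 < P) {ρ s : ℂ} (h : |s.re - ρ.re| < 2 * P) :
    dslope (stripNum P ρ) ρ s ≠ 0 := by
  by_cases hne : s = ρ
  · subst hne
    rw [dslope_same]
    have : HasDerivAt (stripNum P s) (Complex.cos ((π / (4 * P) : ℝ) * (s - s)) *
        ((π / (4 * P) : ℝ) * 1)) s := by
      unfold stripNum
      exact (((hasDerivAt_id s).sub_const s).const_mul ((π / (4 * P) : ℝ) : ℂ)).csin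
    rw [this.deriv]
    have : π / (4 * P) ≠ 0 := by positivity
    simpa using hP.ne'
  · rw [dslope_of_ne _ hne, slope_def_field, stripNum_self, sub_zero]
    exact div_ne_zero (stripNum_ne_zero hP h hne) (sub_ne_zero.2 hne)

theorem differentiableAt_dslope_of_nhds {f : ℂ → ℂ} {ρ z : ℂ}
    (hz : DifferentiableAt ℂ f z) (hρ : ∀ᶠ w in nhds ρ, DifferentiableAt ℂ f w) :
    DifferentiableAt ℂ (dslope f ρ) z := by
  by_cases h : z = ρ
  · subst h
    have : DifferentiableOn ℂ (dslope f z) {w | DifferentiableAt ℂ f w} :=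
      (Complex.differentiableOn_dslope hρ).2 fun w hw => DifferentiableAt.differentiableWithinAt hw
    exact this.differentiableAt hρ
  · exact (differentiableAt_dslope_of_ne h).2 hz

/-- Dividing out a zero by the Blaschke factor of the strip. -/
theorem exists_strip_quotient {l P : ℝ} (hP : 0 < P) {f : ℂ → ℂ} {ρ : ℂ}
    (hd : ∀ z : ℂ, l ≤ z.re → z.re ≤ l + 2 * P → DifferentiableAt ℂ f z)
    (hρ1 : l < ρ.re) (hρ2 : ρ.re < l + 2 * P) (hf : f ρ = 0) :
    ∃ g : ℂ → ℂ, (∀ z : ℂ, l ≤ z.re → z.re ≤ l + 2 * P → DifferentiableAt ℂ g z) ∧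
      ∀ z, l ≤ z.re → z.re ≤ l + 2 * P → f z * stripDen l P ρ z = g z * stripNum P ρ z := by
  have habs : ∀ z : ℂ, l ≤ z.re → z.re ≤ l + 2 * P → |z.re - ρ.re| < 2 * P := fun z h1 h2 =>
    abs_lt.2 ⟨by linarith, by linarith⟩
  refine ⟨fun z => dslope f ρ z * stripDen l P ρ z / dslope (stripNum P ρ) ρ z, ?_, ?_⟩
  · intro z h1 h2
    refine DifferentiableAt.div (DifferentiableAt.mul ?_ (differentiable_stripDen l P ρ z)) ?_
      (dslope_stripNum_ne_zero hP (habs z h1 h2))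
    · refine differentiableAt_dslope_of_nhds (hd z h1 h2) ?_
      have h3 : ∀ᶠ w : ℂ in nhds ρ, l < w.re :=
        Complex.continuous_re.continuousAt.eventually (lt_mem_nhds hρ1)
      have h4 : ∀ᶠ w : ℂ in nhds ρ, w.re < l + 2 * P :=
        Complex.continuous_re.continuousAt.eventually (gt_mem_nhds hρ2)
      filter_upwards [h3, h4] with w h5 h6 using hd w h5.le h6.le
    · exact differentiableAt_dslope_of_nhds (differentiable_stripNum P ρ z)
        (Filter.Eventually.of_forall fun w => differentiable_stripNum P ρ w)
  · intro z h1 h2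
    have hD := dslope_stripNum_ne_zero hP (habs z h1 h2)
    have e1 : f z = (z - ρ) * dslope f ρ z := by
      have := sub_smul_dslope f ρ z
      rw [smul_eq_mul, hf, sub_zero] at this
      exact this.symm
    have e2 : stripNum P ρ z = (z - ρ) * dslope (stripNum P ρ) ρ z := by
      have := sub_smul_dslope (stripNum P ρ) ρ z
      rw [smul_eq_mul, stripNum_self, sub_zero] at this
      exact this.symm
    rw [e1, e2]
    field_simp

theorem exists_norm_stripDen_le {l P : ℝ} (hP : 0 < P) (ρ : ℂ) :
    ∃ Y : ℝ, ∀ z : ℂ, Y ≤ |z.im| → 0 < ‖stripNum P ρ z‖ ∧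
      ‖stripDen l P ρ z‖ ≤ 2 * ‖stripNum P ρ z‖ := by
  have hu : 0 < π / (2 * P) := by positivity
  refine ⟨|ρ.im| + 2 / (π / (2 * P)), fun z hz => ?_⟩
  have h1 : 2 ≤ |π / (2 * P) * (z.im - ρ.im)| := by
    rw [abs_mul, abs_of_pos hu]
    have := abs_sub_abs_le_abs_sub z.im ρ.im
    calc (2 : ℝ) = π / (2 * P) * (2 / (π / (2 * P))) := by field_simp
      _ ≤ _ := by gcongr; linarith
  have h2 : 2 ≤ Real.cosh (π / (2 * P) * (z.im - ρ.im)) := by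
    rw [← Real.cosh_abs]
    generalize |π / (2 * P) * (z.im - ρ.im)| = y at h1
    have := Real.add_one_le_exp y
    have h3 : Real.cosh y ^ 2 = Real.sinh y ^ 2 + 1 := Real.cosh_sq y
    have h4 : y ≤ Real.sinh y := Real.self_le_sinh_iff.2 (by linarith)
    nlinarith [Real.cosh_pos y]
  have h3 := Real.cos_le_one (π / (2 * P) * (z.re - ρ.re))
  have h4 := Real.neg_one_le_cos (π / (2 * P) * (z.re + ρ.re - 2 * l))
  have hN := norm_stripNum_sq P ρ z
  have hD := norm_stripDen_sq l P ρ z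
  constructor
  · have : 0 < ‖stripNum P ρ z‖ ^ 2 := by rw [hN]; linarith
    exact norm_pos_iff.2 fun h => by simp [h] at this
  · refine (pow_le_pow_iff_left₀ (norm_nonneg _) (by positivity) two_ne_zero).1 ?_
    rw [mul_pow, hN, hD]
    linarith

/-- The maximum principle in a strip after dividing out finitely many zeros. -/
theorem strip_norm_mul_prod_le {l P M : ℝ} (hP : 0 < P) (Z : Finset ℂ) :
    ∀ f : ℂ → ℂ, (∀ z : ℂ, l ≤ z.re → z.re ≤ l + 2 * P → DifferentiableAt ℂ f z) →
    (∃ C Y : ℝ, ∀ z : ℂ, l ≤ z.re → z.re ≤ l + 2 * P → Y ≤ |z.im| → ‖f z‖ ≤ C) →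
    (∀ z : ℂ, z.re = l → ‖f z‖ ≤ M) → (∀ z : ℂ, z.re = l + 2 * P → ‖f z‖ ≤ M) →
    (∀ ρ ∈ Z, l < ρ.re ∧ ρ.re < l + 2 * P ∧ f ρ = 0) →
    ∀ s : ℂ, l ≤ s.re → s.re ≤ l + 2 * P →
      ‖f s‖ * ∏ ρ ∈ Z, ‖stripDen l P ρ s‖ ≤ M * ∏ ρ ∈ Z, ‖stripNum P ρ s‖ := by
  induction Z using Finset.induction_on with
  | empty =>
    intro f hd ⟨C, Y, hC⟩ hl hr _ s h1 h2
    simp only [Finset.prod_empty, mul_one]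
    refine PhragmenLindelof.vertical_strip (a := l) (b := l + 2 * P) ?_ ?_ hl hr h1 h2
    · constructor
      · intro z hz
        exact (hd z hz.1.le hz.2.le).differentiableWithinAt
      · intro z hz
        have : z ∈ Complex.re ⁻¹' Set.Icc l (l + 2 * P) := by
          have hcl : IsClosed (Complex.re ⁻¹' Set.Icc l (l + 2 * P)) :=
            isClosed_Icc.preimage Complex.continuous_re
          exact closure_minimal (Set.preimage_mono Set.Ioo_subset_Icc_self) hcl hz
        exact (hd z this.1 this.2).continuousAt.continuousWithinAt
    · refine ⟨0, by rw [add_sub_cancel_left]; positivity, 0, ?_⟩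
      refine Asymptotics.IsBigO.of_bound C ?_
      have hY : ∀ᶠ z in Filter.comap (abs ∘ Complex.im) Filter.atTop, Y ≤ |z.im| :=
        (Filter.eventually_ge_atTop Y).comap (abs ∘ Complex.im)
      filter_upwards [Filter.mem_inf_of_left hY,
        Filter.mem_inf_of_right (Filter.mem_principal_self _)] with z hz1 hz2
      simpa using hC z hz2.1.le hz2.2.le hz1
  | insert ρ Z hρ ih =>
    intro f hd ⟨C, Y, hC⟩ hl hr hz s h1 h2
    obtain ⟨hρ1, hρ2, hfρ⟩ := hz ρ (Finset.mem_insert_self _ _)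
    obtain ⟨g, hgd, hg⟩ := exists_strip_quotient hP hd hρ1 hρ2 hfρ
    have hne : ∀ z : ℂ, l ≤ z.re → z.re ≤ l + 2 * P → z ≠ ρ → stripNum P ρ z ≠ 0 :=
      fun z h3 h4 h5 => stripNum_ne_zero hP (abs_lt.2 ⟨by linarith, by linarith⟩) h5
    have hgn : ∀ z : ℂ, l ≤ z.re → z.re ≤ l + 2 * P →
        ‖f z‖ * ‖stripDen l P ρ z‖ = ‖g z‖ * ‖stripNum P ρ z‖ := by
      intro z h3 h4
      rw [← norm_mul, hg z h3 h4, norm_mul]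
    have key := ih g hgd ?_ ?_ ?_ ?_ s h1 h2
    · rw [Finset.prod_insert hρ, Finset.prod_insert hρ, ← mul_assoc, hgn s h1 h2]
      calc _ = (‖g s‖ * ∏ ρ ∈ Z, ‖stripDen l P ρ s‖) * ‖stripNum P ρ s‖ := by ring
        _ ≤ (M * ∏ ρ ∈ Z, ‖stripNum P ρ s‖) * ‖stripNum P ρ s‖ := by gcongr
        _ = _ := by ring
    · obtain ⟨Y', hY'⟩ := exists_norm_stripDen_le (l := l) hP ρ
      refine ⟨C * 2, max Y Y', fun z h3 h4 h5 => ?_⟩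
      obtain ⟨h6, h7⟩ := hY' z (le_trans (le_max_right _ _) h5)
      refine le_of_mul_le_mul_right ?_ h6
      rw [← hgn z h3 h4]
      have h8 := hC z h3 h4 (le_trans (le_max_left _ _) h5)
      calc _ ≤ C * (2 * ‖stripNum P ρ z‖) := by
            gcongr
            exact le_trans (norm_nonneg _) h8
        _ = _ := by ring
    · intro z h3
      have h4 : stripNum P ρ z ≠ 0 := hne z h3.ge (by linarith) (by rintro rfl; linarith)
      have h5 := hgn z h3.ge (by linarith)
      rw [← norm_stripNum_eq_left h3] at h5
      rw [← mul_right_cancel₀ (norm_ne_zero_iff.2 h4) h5]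
      exact hl z h3
    · intro z h3
      have h4 : stripNum P ρ z ≠ 0 := hne z (by linarith) h3.le (by rintro rfl; linarith)
      have h5 := hgn z (by linarith) h3.le
      rw [← norm_stripNum_eq_right hP h3] at h5
      rw [← mul_right_cancel₀ (norm_ne_zero_iff.2 h4) h5]
      exact hr z h3
    · intro z hzZ
      obtain ⟨h3, h4, h5⟩ := hz z (Finset.mem_insert_of_mem hzZ)
      refine ⟨h3, h4, ?_⟩
      have h6 := hg z h3.le h4.le
      rw [h5, zero_mul] at h6
      exact (mul_eq_zero.1 h6.symm).resolve_right
        (hne z h3.le h4.le (by rintro rfl; exact hρ hzZ))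

theorem two_mul_le_log_sub_log {x : ℝ} (h0 : 0 ≤ x) (h1 : x < 1) :
    2 * x ≤ Real.log (1 + x) - Real.log (1 - x) := by
  have h := Real.hasSum_log_sub_log_of_abs_lt_one (abs_lt.2 ⟨by linarith, h1⟩)
  have := sum_le_hasSum {0} (fun k _ => by positivity) h
  simpa using this

/-- A Jensen inequality on a strip: zeros in the left half force `f` to be small on the
middle line. -/
theorem strip_jensen {l P Ml Mr : ℝ} (hP : 0 < P) (hMl : 0 < Ml) (hMr : 0 < Mr)
    (Z : Finset ℂ) (f : ℂ → ℂ)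
    (hd : ∀ z : ℂ, l ≤ z.re → z.re ≤ l + 2 * P → DifferentiableAt ℂ f z)
    (hC : ∃ C : ℝ, ∀ z : ℂ, l ≤ z.re → z.re ≤ l + 2 * P → ‖f z‖ ≤ C)
    (hl : ∀ z : ℂ, z.re = l → ‖f z‖ ≤ Ml) (hr : ∀ z : ℂ, z.re = l + 2 * P → ‖f z‖ ≤ Mr)
    (hZ : ∀ ρ ∈ Z, l < ρ.re ∧ ρ.re < l + P ∧ f ρ = 0)
    {c : ℂ} (hc : c.re = l + P) (hfc : f c ≠ 0) :
    ∑ ρ ∈ Z, 2 * (Real.sin (π / (2 * P) * (ρ.re - l)) /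
      Real.cosh (π / (2 * P) * (c.im - ρ.im))) ≤
      Real.log Ml + Real.log Mr - 2 * Real.log ‖f c‖ := by
  set lam : ℝ := (Real.log Ml - Real.log Mr) / (2 * P) with hlam
  set M : ℝ := Real.exp ((Real.log Ml + Real.log Mr) / 2) with hM
  have hexp : ∀ z : ℂ, ‖Complex.exp (lam * (z - c))‖ = Real.exp (lam * (z.re - (l + P))) := by
    intro z
    rw [Complex.norm_exp, Complex.re_ofReal_mul, Complex.sub_re, hc]
  have key := strip_norm_mul_prod_le (l := l) (M := M) hP Z
    (fun z => f z * Complex.exp (lam * (z - c)))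
    ?_ ?_ ?_ ?_ ?_ c (by linarith) (by linarith)
  · simp only [sub_self, mul_zero, Complex.exp_zero, mul_one] at key
    have hterm : ∀ ρ ∈ Z, 0 < ‖stripNum P ρ c‖ ∧ 0 < ‖stripDen l P ρ c‖ ∧
        2 * (Real.sin (π / (2 * P) * (ρ.re - l)) / Real.cosh (π / (2 * P) * (c.im - ρ.im))) ≤
        2 * Real.log ‖stripDen l P ρ c‖ - 2 * Real.log ‖stripNum P ρ c‖ := by
      intro ρ hρ
      obtain ⟨h1, h2, -⟩ := hZ ρ hρ
      have hN := norm_stripNum_sq_center hP (ρ := ρ) hc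
      have hD := norm_stripDen_sq_center hP (ρ := ρ) hc
      set S := Real.sin (π / (2 * P) * (ρ.re - l))
      set K := Real.cosh (π / (2 * P) * (c.im - ρ.im))
      have hu : 0 < π / (2 * P) := by positivity
      have hang : π / (2 * P) * (ρ.re - l) < π / 2 := by
        calc _ < π / (2 * P) * P := by gcongr; linarith
          _ = π / 2 := by field_simp
      have hS0 : 0 < S := Real.sin_pos_of_pos_of_lt_pi (mul_pos hu (by linarith))
        (by linarith [Real.pi_pos])
      have hS1 : S < 1 := by
        have := Real.sin_lt_sin_of_lt_of_le_pi_div_two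
          (by linarith [mul_pos hu (sub_pos.2 h1), Real.pi_pos]) le_rfl hang
        rwa [Real.sin_pi_div_two] at this
      have hK : 1 ≤ K := Real.one_le_cosh _
      have hN0 : 0 < ‖stripNum P ρ c‖ := by
        have : 0 < ‖stripNum P ρ c‖ ^ 2 := by rw [hN]; linarith
        exact norm_pos_iff.2 fun h => by simp [h] at this
      have hD0 : 0 < ‖stripDen l P ρ c‖ := by
        have : 0 < ‖stripDen l P ρ c‖ ^ 2 := by rw [hD]; linarith
        exact norm_pos_iff.2 fun h => by simp [h] at this
      refine ⟨hN0, hD0, ?_⟩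
      have hx0 : 0 ≤ S / K := by positivity
      have hx1 : S / K < 1 := by rw [div_lt_one (by linarith)]; linarith
      refine (two_mul_le_log_sub_log hx0 hx1).trans (le_of_eq ?_)
      have e1 : 2 * Real.log ‖stripDen l P ρ c‖ = Real.log ((K + S) / 2) := by
        rw [← hD, Real.log_pow]; norm_num
      have e2 : 2 * Real.log ‖stripNum P ρ c‖ = Real.log ((K - S) / 2) := by
        rw [← hN, Real.log_pow]; norm_num
      rw [e1, e2, ← Real.log_div (by linarith) (by linarith),
        ← Real.log_div (by positivity) (by linarith)]
      congr 1
      have : K - S ≠ 0 := by linarith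
      have : K ≠ 0 := by linarith
      field_simp
    have hNp : 0 < ∏ ρ ∈ Z, ‖stripNum P ρ c‖ := Finset.prod_pos fun ρ h => (hterm ρ h).1
    have hDp : 0 < ∏ ρ ∈ Z, ‖stripDen l P ρ c‖ := Finset.prod_pos fun ρ h => (hterm ρ h).2.1
    have hfc' : 0 < ‖f c‖ := norm_pos_iff.2 hfc
    have hlog := Real.log_le_log (by positivity) key
    rw [Real.log_mul hfc'.ne' hDp.ne', Real.log_mul (Real.exp_pos _).ne' hNp.ne', Real.log_exp,
      Real.log_prod (fun ρ h => (hterm ρ h).2.1.ne'),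
      Real.log_prod (fun ρ h => (hterm ρ h).1.ne')] at hlog
    have hsum := Finset.sum_le_sum fun ρ h => (hterm ρ h).2.2
    rw [Finset.sum_sub_distrib, ← Finset.mul_sum, ← Finset.mul_sum, ← Finset.mul_sum] at hsum
    rw [← Finset.mul_sum]
    linarith
  · intro z h1 h2
    exact (hd z h1 h2).mul (by fun_prop)
  · obtain ⟨C, hC⟩ := hC
    refine ⟨C * Real.exp (|lam| * P), 0, fun z h1 h2 _ => ?_⟩
    have h3 := hC z h1 h2
    rw [norm_mul, hexp]
    have : lam * (z.re - (l + P)) ≤ |lam| * P := by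
      refine (le_abs_self _).trans ?_
      rw [abs_mul]
      gcongr
      exact abs_le.2 ⟨by linarith, by linarith⟩
    gcongr
    exact (norm_nonneg _).trans h3
  · intro z h1
    rw [norm_mul, hexp, h1]
    calc _ ≤ Ml * Real.exp (lam * (l - (l + P))) := by gcongr; exact hl z h1
      _ = Real.exp (Real.log Ml + lam * (l - (l + P))) := by rw [Real.exp_add, Real.exp_log hMl]
      _ = M := by
        rw [hM, hlam]; congr 1; field_simp; ring
  · intro z h1
    rw [norm_mul, hexp, h1]
    calc _ ≤ Mr * Real.exp (lam * (l + 2 * P - (l + P))) := by gcongr; exact hr z h1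
      _ = Real.exp (Real.log Mr + lam * (l + 2 * P - (l + P))) := by
        rw [Real.exp_add, Real.exp_log hMr]
      _ = M := by
        rw [hM, hlam]; congr 1; field_simp; ring
  · intro ρ hρ
    obtain ⟨h1, h2, h3⟩ := hZ ρ hρ
    exact ⟨h1, by linarith, by simp [h3]⟩

/-! ### Beurling systems satisfying Axiom A -/

/-- A Beurling system with locally finite norms satisfying Axiom A. -/
structure IsAxiomA (q : ℕ → ℝ) (κ A θ : ℝ) : Prop where
  one_lt : ∀ i, 1 < q i
  finite : ∀ x : ℝ, {g : ℕ →₀ ℕ | bNorm q g ≤ x}.Finite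
  kappa_pos : 0 < κ
  A_pos : 0 < A
  theta_pos : 0 < θ
  theta_lt_one : θ < 1
  abs_bR_le : ∀ x : ℝ, 1 ≤ x → |bR q κ x| ≤ A * x ^ θ

/-- The integral `∫_1^∞ R(x) x^(-s-1) dx`. -/
noncomputable def bInt (q : ℕ → ℝ) (κ : ℝ) (s : ℂ) : ℂ :=
  ∫ x in Set.Ioi (1 : ℝ), (bR q κ x : ℂ) * (x : ℂ) ^ (-s - 1)

/-- The function `(s - 1) ζ(s)` with its removable singularity removed. -/
noncomputable def bZetaReg (q : ℕ → ℝ) (κ : ℝ) (s : ℂ) : ℂ :=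
  κ + (s - 1) * s * bInt q κ s

theorem bZetaReg_eq {q : ℕ → ℝ} {κ : ℝ} {s : ℂ} (hs : s ≠ 1) :
    bZetaReg q κ s = (s - 1) * bZeta q κ s := by
  have : s - 1 ≠ 0 := sub_ne_zero.2 hs
  rw [bZetaReg, bZeta, bInt]
  field_simp

theorem bZeta_conj (q : ℕ → ℝ) (κ : ℝ) (s : ℂ) :
    bZeta q κ ((starRingEnd ℂ) s) = (starRingEnd ℂ) (bZeta q κ s) := by
  unfold bZeta
  rw [map_add, map_mul, map_div₀, map_sub, map_one, Complex.conj_ofReal, ← integral_conj]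
  congr 2
  refine MeasureTheory.setIntegral_congr_fun measurableSet_Ioi fun x hx => ?_
  have hx0 : (0 : ℝ) < x := lt_trans one_pos hx
  simp only [map_mul, Complex.conj_ofReal]
  congr 1
  rw [show -(starRingEnd ℂ) s - 1 = (starRingEnd ℂ) (-s - 1) by simp, Complex.cpow_conj,
    Complex.conj_ofReal]
  rw [Complex.arg_ofReal_of_nonneg hx0.le]
  exact Real.pi_pos.ne

theorem neg_sub_one_re_lt {s : ℂ} (hs : 0 < s.re) : (-s - 1).re < -1 := by
  simp only [Complex.sub_re, Complex.neg_re, Complex.one_re]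
  linarith

namespace IsAxiomA

variable {q : ℕ → ℝ} {κ A θ : ℝ}

theorem one_le_bNorm (h : IsAxiomA q κ A θ) (g : ℕ →₀ ℕ) : 1 ≤ bNorm q g := by
  unfold bNorm Finsupp.prod
  exact Finset.one_le_prod fun i _ => one_le_pow₀ (h.one_lt i).le

theorem bNorm_pos (h : IsAxiomA q κ A θ) (g : ℕ →₀ ℕ) : 0 < bNorm q g :=
  one_pos.trans_le (h.one_le_bNorm g)

theorem bN_mono (h : IsAxiomA q κ A θ) : Monotone (bN q) := fun _ _ hxy =>
  Set.ncard_le_ncard (fun _ hg => le_trans hg hxy) (h.finite _)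

theorem measurable_bR (h : IsAxiomA q κ A θ) : Measurable (bR q κ) := by
  unfold bR
  have : Measurable fun x => (bN q x : ℝ) :=
    (Nat.mono_cast.comp h.bN_mono).measurable
  fun_prop

theorem bN_le (h : IsAxiomA q κ A θ) {x : ℝ} (hx : 1 ≤ x) : (bN q x : ℝ) ≤ (A + κ) * x := by
  have h1 := (abs_le.1 (h.abs_bR_le x hx)).2
  have h2 : x ^ θ ≤ x := by
    simpa using Real.rpow_le_rpow_of_exponent_le hx h.theta_lt_one.le
  have h3 := mul_le_mul_of_nonneg_left h2 h.A_pos.le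
  have := h.kappa_pos
  unfold bR at h1
  linarith

theorem norm_integrand_le (h : IsAxiomA q κ A θ) (s : ℂ) {x : ℝ} (hx : 1 < x) :
    ‖(bR q κ x : ℂ) * (x : ℂ) ^ (-s - 1)‖ ≤ A * x ^ (θ - s.re - 1) := by
  have hx0 : 0 < x := one_pos.trans hx
  rw [norm_mul, Complex.norm_real, Complex.norm_cpow_eq_rpow_re_of_pos hx0]
  calc _ ≤ A * x ^ θ * x ^ (-s - 1).re := by
        gcongr
        exact h.abs_bR_le x hx.le
    _ = _ := by
        rw [mul_assoc, ← Real.rpow_add hx0]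
        congr 2
        simp; ring

theorem integrableOn_integrand (h : IsAxiomA q κ A θ) {s : ℂ} (hs : θ < s.re) :
    MeasureTheory.IntegrableOn (fun x : ℝ => (bR q κ x : ℂ) * (x : ℂ) ^ (-s - 1))
      (Set.Ioi 1) := by
  have hint : MeasureTheory.IntegrableOn (fun x : ℝ => A * x ^ (θ - s.re - 1)) (Set.Ioi 1) :=
    (integrableOn_Ioi_rpow_of_lt (by linarith) one_pos).const_mul A
  refine MeasureTheory.Integrable.mono' hint ?_ ?_
  · have h1 := h.measurable_bR
    refine Measurable.aestronglyMeasurable ?_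
    fun_prop
  · filter_upwards [MeasureTheory.ae_restrict_mem measurableSet_Ioi] with x hx
    exact h.norm_integrand_le s hx

theorem norm_bInt_le (h : IsAxiomA q κ A θ) {s : ℂ} (hs : θ < s.re) :
    ‖bInt q κ s‖ ≤ A / (s.re - θ) := by
  have hint : MeasureTheory.IntegrableOn (fun x : ℝ => A * x ^ (θ - s.re - 1)) (Set.Ioi 1) :=
    (integrableOn_Ioi_rpow_of_lt (by linarith) one_pos).const_mul A
  refine (MeasureTheory.norm_integral_le_of_norm_le hint ?_).trans (le_of_eq ?_)
  · filter_upwards [MeasureTheory.ae_restrict_mem measurableSet_Ioi] with x hx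
    exact h.norm_integrand_le s hx
  · rw [MeasureTheory.integral_const_mul, integral_Ioi_rpow_of_lt (by linarith) one_pos,
      Real.one_rpow]
    have h1 : s.re - θ ≠ 0 := by linarith
    have h2 : θ - s.re - 1 + 1 ≠ 0 := by intro h0; apply h1; linarith
    field_simp
    ring

theorem differentiableAt_bInt (h : IsAxiomA q κ A θ) {s : ℂ} (hs : θ < s.re) :
    DifferentiableAt ℂ (bInt q κ) s := by
  set f : ℝ → ℂ := (Set.Ioi (1 : ℝ)).indicator fun x => (bR q κ x : ℂ) with hf
  have hfb : ∀ x : ℝ, ‖f x‖ ≤ ‖A * x ^ θ‖ := by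
    intro x
    by_cases hx : x ∈ Set.Ioi (1 : ℝ)
    · rw [hf, Set.indicator_of_mem hx, Complex.norm_real]
      exact (h.abs_bR_le x (le_of_lt hx)).trans (le_abs_self _)
    · rw [hf, Set.indicator_of_notMem hx, norm_zero]
      positivity
  have hm : MeasureTheory.LocallyIntegrableOn f (Set.Ioi 0) := by
    refine MeasureTheory.LocallyIntegrableOn.mono (f := fun x : ℝ => A * x ^ θ) ?_ ?_
      (Filter.Eventually.of_forall hfb)
    · refine ContinuousOn.locallyIntegrableOn ?_ measurableSet_Ioi
      refine ContinuousOn.mul continuousOn_const ?_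
      exact ContinuousOn.rpow_const continuousOn_id fun x hx => Or.inl (ne_of_gt hx)
    · have h1 := h.measurable_bR
      exact (Measurable.indicator (by fun_prop) measurableSet_Ioi).aestronglyMeasurable
  have hmel : DifferentiableAt ℂ (mellin f) (-s) := by
    refine mellin_differentiableAt_of_isBigO_rpow (a := -θ) (b := (-s).re - 1) hm ?_ ?_ ?_ ?_
    · refine Asymptotics.IsBigO.of_bound A (Filter.Eventually.of_forall fun x => ?_)
      refine (hfb x).trans ?_
      rw [norm_mul, Real.norm_of_nonneg h.A_pos.le, neg_neg]
    · simpa using hs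
    · have : f =ᶠ[nhdsWithin 0 (Set.Ioi 0)] fun _ => 0 := by
        have h1 : ∀ᶠ x : ℝ in nhdsWithin 0 (Set.Ioi 0), x < 1 :=
          Filter.Eventually.filter_mono nhdsWithin_le_nhds (gt_mem_nhds one_pos)
        filter_upwards [h1] with x hx
        exact Set.indicator_of_notMem (by simpa using hx.le) _
      exact this.trans_isBigO (Asymptotics.isBigO_zero _ _)
    · linarith
  have heq : bInt q κ = fun z => mellin f (-z) := by
    funext z
    have : ∀ x : ℝ, (x : ℂ) ^ (-z - 1) • f x =
        (Set.Ioi (1 : ℝ)).indicator (fun x : ℝ => (bR q κ x : ℂ) * (x : ℂ) ^ (-z - 1)) x := by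
      intro x
      rw [hf]
      by_cases hx : x ∈ Set.Ioi (1 : ℝ)
      · simp only [Set.indicator_of_mem hx, smul_eq_mul, mul_comm]
      · simp only [Set.indicator_of_notMem hx, smul_zero]
    simp only [mellin, this]
    rw [MeasureTheory.setIntegral_indicator measurableSet_Ioi, bInt]
    congr 2
    ext x
    simp only [Set.mem_inter_iff, Set.mem_Ioi]
    exact ⟨fun h1 => ⟨one_pos.trans h1, h1⟩, fun h1 => h1.2⟩
  rw [heq]
  exact DifferentiableAt.comp (g := mellin f) (f := fun z => -z) s hmel differentiableAt_fun_id.neg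

theorem differentiableAt_bZetaReg (h : IsAxiomA q κ A θ) {s : ℂ} (hs : θ < s.re) :
    DifferentiableAt ℂ (bZetaReg q κ) s := by
  have := h.differentiableAt_bInt hs
  unfold bZetaReg
  fun_prop

theorem differentiableAt_bZeta (h : IsAxiomA q κ A θ) {s : ℂ} (hs : 1 < s.re) :
    DifferentiableAt ℂ (bZeta q κ) s := by
  have h1 := h.differentiableAt_bInt (h.theta_lt_one.trans hs)
  have h2 : s - 1 ≠ 0 := sub_ne_zero.2 (by rintro rfl; simp at hs)
  change DifferentiableAt ℂ (fun s => (κ : ℂ) / (s - 1) + s * bInt q κ s) s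
  fun_prop (disch := assumption)

theorem integral_tail (h : IsAxiomA q κ A θ) {s : ℂ} (hs : 0 < s.re) (g : ℕ →₀ ℕ) :
    ∫ x : ℝ, (Set.Ici (bNorm q g)).indicator (fun x : ℝ => (x : ℂ) ^ (-s - 1)) x =
      (bNorm q g : ℂ) ^ (-s) / s := by
  rw [MeasureTheory.integral_indicator measurableSet_Ici, MeasureTheory.integral_Ici_eq_integral_Ioi,
    integral_Ioi_cpow_of_lt (neg_sub_one_re_lt hs) (h.bNorm_pos g)]
  have : s ≠ 0 := by rintro rfl; simp at hs
  rw [sub_add_cancel]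
  field_simp

theorem integral_tail_real (h : IsAxiomA q κ A θ) {σ : ℝ} (hσ : 0 < σ) (g : ℕ →₀ ℕ) :
    ∫ x : ℝ, (Set.Ici (bNorm q g)).indicator (fun x : ℝ => x ^ (-σ - 1)) x =
      bNorm q g ^ (-σ) / σ := by
  rw [MeasureTheory.integral_indicator measurableSet_Ici, MeasureTheory.integral_Ici_eq_integral_Ioi,
    integral_Ioi_rpow_of_lt (by linarith) (h.bNorm_pos g), sub_add_cancel]
  field_simp

theorem integrable_tail_real (h : IsAxiomA q κ A θ) {σ : ℝ} (hσ : 0 < σ) (g : ℕ →₀ ℕ) :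
    MeasureTheory.Integrable ((Set.Ici (bNorm q g)).indicator (fun x : ℝ => x ^ (-σ - 1))) := by
  rw [MeasureTheory.integrable_indicator_iff measurableSet_Ici, integrableOn_Ici_iff_integrableOn_Ioi]
  exact integrableOn_Ioi_rpow_of_lt (by linarith) (h.bNorm_pos g)

theorem sum_tail_le (h : IsAxiomA q κ A θ) (σ : ℝ) (S : Finset (ℕ →₀ ℕ)) (x : ℝ) :
    ∑ g ∈ S, (Set.Ici (bNorm q g)).indicator (fun x : ℝ => x ^ (-σ - 1)) x ≤
      (Set.Ici 1).indicator (fun x : ℝ => (A + κ) * x ^ (-σ)) x := by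
  classical
  by_cases hx : x ∈ Set.Ici (1 : ℝ)
  · have hx1 : (1 : ℝ) ≤ x := hx
    have hx0 : 0 < x := one_pos.trans_le hx1
    rw [Set.indicator_of_mem hx]
    have : ∀ g ∈ S, (Set.Ici (bNorm q g)).indicator (fun x : ℝ => x ^ (-σ - 1)) x =
        (if bNorm q g ≤ x then 1 else 0) * x ^ (-σ - 1) := by
      intro g _
      by_cases hg : bNorm q g ≤ x <;> simp [hg]
    rw [Finset.sum_congr rfl this, ← Finset.sum_mul, Finset.sum_boole]
    have hcard : ((S.filter fun g => bNorm q g ≤ x).card : ℝ) ≤ bN q x := by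
      rw [bN, Set.ncard_eq_toFinset_card _ (h.finite x)]
      exact_mod_cast Finset.card_le_card fun g hg => by simpa using (Finset.mem_filter.1 hg).2
    calc _ ≤ (A + κ) * x * x ^ (-σ - 1) := by
          gcongr
          exact hcard.trans (h.bN_le hx1)
      _ = _ := by
          rw [Real.rpow_sub_one hx0.ne']
          field_simp
  · rw [Set.indicator_of_notMem hx, Finset.sum_eq_zero]
    intro g _
    refine Set.indicator_of_notMem (fun hg => hx ?_) _
    exact (h.one_le_bNorm g).trans hg

theorem sum_norm_rpow_le (h : IsAxiomA q κ A θ) {σ : ℝ} (hσ : 1 < σ) (S : Finset (ℕ →₀ ℕ)) :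
    ∑ g ∈ S, bNorm q g ^ (-σ) ≤ σ / (σ - 1) * (A + κ) := by
  have hσ0 : 0 < σ := one_pos.trans hσ
  have h1 : ∑ g ∈ S, bNorm q g ^ (-σ) / σ ≤ (A + κ) / (σ - 1) := by
    simp_rw [← h.integral_tail_real hσ0]
    rw [← MeasureTheory.integral_finsetSum S fun g _ => h.integrable_tail_real hσ0 g]
    have hint : MeasureTheory.IntegrableOn (fun x : ℝ => (A + κ) * x ^ (-σ)) (Set.Ioi 1) :=
      (integrableOn_Ioi_rpow_of_lt (by linarith) one_pos).const_mul _
    refine (MeasureTheory.integral_mono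
      (MeasureTheory.integrable_finsetSum S fun g _ => h.integrable_tail_real hσ0 g) ?_
      fun x => h.sum_tail_le σ S x).trans (le_of_eq ?_)
    · rwa [MeasureTheory.integrable_indicator_iff measurableSet_Ici,
        integrableOn_Ici_iff_integrableOn_Ioi]
    · rw [MeasureTheory.integral_indicator measurableSet_Ici,
        MeasureTheory.integral_Ici_eq_integral_Ioi, MeasureTheory.integral_const_mul,
        integral_Ioi_rpow_of_lt (by linarith) one_pos, Real.one_rpow]
      have h2 : σ - 1 ≠ 0 := by linarith
      have h3 : -σ + 1 ≠ 0 := by intro h0; apply h2; linarith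
      field_simp
      ring
  rw [← Finset.sum_div, div_le_iff₀ hσ0] at h1
  calc _ ≤ _ := h1
    _ = _ := by ring

theorem summable_rpow (h : IsAxiomA q κ A θ) {σ : ℝ} (hσ : 1 < σ) :
    Summable fun g => bNorm q g ^ (-σ) :=
  summable_of_sum_le (fun g => Real.rpow_nonneg (h.bNorm_pos g).le _) (h.sum_norm_rpow_le hσ)

theorem tsum_rpow_le (h : IsAxiomA q κ A θ) {σ : ℝ} (hσ : 1 < σ) :
    ∑' g, bNorm q g ^ (-σ) ≤ σ / (σ - 1) * (A + κ) :=
  (h.summable_rpow hσ).tsum_le_of_sum_le (h.sum_norm_rpow_le hσ)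

theorem norm_tail (h : IsAxiomA q κ A θ) (s : ℂ) (g : ℕ →₀ ℕ) (x : ℝ) :
    ‖(Set.Ici (bNorm q g)).indicator (fun x : ℝ => (x : ℂ) ^ (-s - 1)) x‖ =
      (Set.Ici (bNorm q g)).indicator (fun x : ℝ => x ^ (-s.re - 1)) x := by
  by_cases hx : x ∈ Set.Ici (bNorm q g)
  · rw [Set.indicator_of_mem hx, Set.indicator_of_mem hx,
      Complex.norm_cpow_eq_rpow_re_of_pos ((h.bNorm_pos g).trans_le hx)]
    simp
  · rw [Set.indicator_of_notMem hx, Set.indicator_of_notMem hx, norm_zero]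

/-- In the half-plane of absolute convergence the zeta function is its Dirichlet series. -/
theorem bZeta_eq_tsum (h : IsAxiomA q κ A θ) {s : ℂ} (hs : 1 < s.re) :
    bZeta q κ s = ∑' g, (bNorm q g : ℂ) ^ (-s) := by
  have hs0 : 0 < s.re := one_pos.trans hs
  have hsne : s ≠ 0 := by rintro rfl; simp at hs0
  have hs1 : s - 1 ≠ 0 := sub_ne_zero.2 (by rintro rfl; simp at hs)
  have hint : ∀ g : ℕ →₀ ℕ, MeasureTheory.Integrable
      ((Set.Ici (bNorm q g)).indicator (fun x : ℝ => (x : ℂ) ^ (-s - 1))) := by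
    intro g
    rw [MeasureTheory.integrable_indicator_iff measurableSet_Ici,
      integrableOn_Ici_iff_integrableOn_Ioi]
    exact integrableOn_Ioi_cpow_of_lt (neg_sub_one_re_lt hs0) (h.bNorm_pos g)
  have hsum := MeasureTheory.hasSum_integral_of_summable_integral_norm hint (by
    simp_rw [h.norm_tail s, h.integral_tail_real hs0]
    exact (h.summable_rpow hs).div_const _)
  simp_rw [h.integral_tail hs0] at hsum
  have hcount : ∀ x : ℝ, ∑' g : ℕ →₀ ℕ,
      (Set.Ici (bNorm q g)).indicator (fun x : ℝ => (x : ℂ) ^ (-s - 1)) x =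
      (Set.Ici 1).indicator (fun x : ℝ => (bN q x : ℂ) * (x : ℂ) ^ (-s - 1)) x := by
    intro x
    rw [tsum_eq_sum (s := (h.finite x).toFinset) fun g hg => Set.indicator_of_notMem
      (fun h1 => hg (by simpa using h1)) _]
    rw [Finset.sum_congr rfl fun g hg => Set.indicator_of_mem
      (show x ∈ Set.Ici (bNorm q g) by simpa using hg) _, Finset.sum_const,
      ← Set.ncard_eq_toFinset_card _ (h.finite x), nsmul_eq_mul]
    by_cases hx : x ∈ Set.Ici (1 : ℝ)
    · rw [Set.indicator_of_mem hx, bN]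
    · rw [Set.indicator_of_notMem hx]
      have : {g : ℕ →₀ ℕ | bNorm q g ≤ x} = ∅ := by
        ext g
        simp only [Set.mem_ofPred_eq, Set.mem_empty_iff_false, iff_false]
        exact fun h1 => hx ((h.one_le_bNorm g).trans h1)
      simp [this]
  simp_rw [hcount] at hsum
  rw [MeasureTheory.integral_indicator measurableSet_Ici,
    MeasureTheory.integral_Ici_eq_integral_Ioi] at hsum
  have hsplit : ∫ x in Set.Ioi (1 : ℝ), (bN q x : ℂ) * (x : ℂ) ^ (-s - 1) =
      bInt q κ s + κ * (1 / (s - 1) - 1 / s) := by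
    have e1 : ∫ x in Set.Ioi (1 : ℝ), ((x : ℂ) ^ (-s) - (x : ℂ) ^ (-s - 1)) =
        1 / (s - 1) - 1 / s := by
      rw [MeasureTheory.integral_sub (integrableOn_Ioi_cpow_of_lt (by simpa using hs) one_pos)
        (integrableOn_Ioi_cpow_of_lt (neg_sub_one_re_lt hs0) one_pos),
        integral_Ioi_cpow_of_lt (by simpa using hs) one_pos,
        integral_Ioi_cpow_of_lt (neg_sub_one_re_lt hs0) one_pos]
      have : -s + 1 ≠ 0 := by intro h0; apply hs1; linear_combination -h0
      simp only [Complex.ofReal_one, Complex.one_cpow, sub_add_cancel]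
      field_simp
      ring
    rw [← e1, ← MeasureTheory.integral_const_mul, bInt, ← MeasureTheory.integral_add]
    · refine MeasureTheory.setIntegral_congr_fun measurableSet_Ioi fun x hx => ?_
      have hx0 : (x : ℂ) ≠ 0 := by
        exact_mod_cast (one_pos.trans (show (1 : ℝ) < x from hx)).ne'
      simp only [bR]
      rw [Complex.cpow_sub _ _ hx0, Complex.cpow_one]
      push_cast
      field_simp
      ring
    · exact h.integrableOn_integrand (h.theta_lt_one.trans hs)
    · exact ((integrableOn_Ioi_cpow_of_lt (by simpa using hs) one_pos).sub
        (integrableOn_Ioi_cpow_of_lt (neg_sub_one_re_lt hs0) one_pos)).const_mul _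
  rw [hsplit] at hsum
  have h2 := (hsum.mul_left s).tsum_eq
  simp_rw [mul_div_cancel₀ _ hsne] at h2
  rw [h2, bZeta, ← bInt]
  field_simp
  ring

end IsAxiomA

/-! ### Euler products over the free commutative monoid -/

section Sieve

variable {𝕜 : Type*} [NormedField 𝕜] [CompleteSpace 𝕜] {φ : (ℕ →₀ ℕ) → 𝕜}

/-- The elements of the monoid not divisible by any of the first `n` generators. -/
def sievedSet (n : ℕ) : Set (ℕ →₀ ℕ) := {g | ∀ j < n, g j = 0}

theorem one_sub_mul_tsum_sieved (hφ : Summable fun g => ‖φ g‖)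
    (hmul : ∀ g g', φ (g + g') = φ g * φ g') (n : ℕ) :
    (1 - φ (Finsupp.single n 1)) * ∑' g, (sievedSet n).indicator φ g =
      ∑' g, (sievedSet (n + 1)).indicator φ g := by
  have hs : Summable φ := hφ.of_norm
  have h1 : ∑' g, (sievedSet n ∩ {g | g n ≠ 0}).indicator φ g =
      φ (Finsupp.single n 1) * ∑' g, (sievedSet n).indicator φ g := by
    rw [← (add_left_injective (Finsupp.single n 1)).tsum_eq, ← tsum_mul_left]
    · refine tsum_congr fun g => ?_
      have hiff : g + Finsupp.single n 1 ∈ sievedSet n ∩ {g | g n ≠ 0} ↔ g ∈ sievedSet n := by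
        constructor
        · rintro ⟨h, -⟩ j hj
          have := h j hj
          rw [Finsupp.add_apply] at this
          omega
        · refine fun h => ⟨fun j hj => ?_, ?_⟩
          · rw [Finsupp.add_apply, h j hj, Finsupp.single_apply, if_neg hj.ne', add_zero]
          · simp
      by_cases hg : g ∈ sievedSet n
      · rw [Set.indicator_of_mem hg, Set.indicator_of_mem (hiff.2 hg), hmul, mul_comm]
      · rw [Set.indicator_of_notMem hg, Set.indicator_of_notMem (mt hiff.1 hg), mul_zero]
    · intro g hg
      have hgn : g n ≠ 0 := (Set.mem_of_indicator_ne_zero hg).2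
      refine ⟨g - Finsupp.single n 1, ?_⟩
      refine tsub_add_cancel_of_le ?_
      rw [Finsupp.single_le_iff]
      omega
  have h2 : (sievedSet n).indicator φ =
      fun g => (sievedSet (n + 1)).indicator φ g +
        (sievedSet n ∩ {g | g n ≠ 0}).indicator φ g := by
    have hun : sievedSet n = sievedSet (n + 1) ∪ (sievedSet n ∩ {g | g n ≠ 0}) := by
      ext g
      constructor
      · intro h
        by_cases hg : g n = 0
        · refine Or.inl fun j hj => ?_
          rcases Nat.lt_succ_iff_lt_or_eq.1 hj with h3 | rfl
          exacts [h j h3, hg]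
        · exact Or.inr ⟨h, hg⟩
      · rintro (h | h)
        · exact fun j hj => h j (by omega)
        · exact h.1
    have hdisj : Disjoint (sievedSet (n + 1)) (sievedSet n ∩ {g | g n ≠ 0}) :=
      Set.disjoint_left.2 fun g h h3 => h3.2 (h n (by omega))
    conv_lhs => rw [hun]
    exact Set.indicator_union_of_disjoint hdisj φ
  have h3 : ∑' g, (sievedSet n).indicator φ g = ∑' g, (sievedSet (n + 1)).indicator φ g +
      ∑' g, (sievedSet n ∩ {g | g n ≠ 0}).indicator φ g := by
    rw [← (hs.indicator _).tsum_add (hs.indicator _), ← h2]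
  rw [sub_mul, one_mul, ← h1, h3, add_sub_cancel_right]

theorem prod_one_sub_mul_tsum (hφ : Summable fun g => ‖φ g‖)
    (hmul : ∀ g g', φ (g + g') = φ g * φ g') (n : ℕ) :
    (∏ i ∈ Finset.range n, (1 - φ (Finsupp.single i 1))) * ∑' g, φ g =
      ∑' g, (sievedSet n).indicator φ g := by
  induction n with
  | zero =>
    have : sievedSet 0 = Set.univ := Set.eq_univ_of_forall fun g j hj => absurd hj (by omega)
    simp [this]
  | succ n ih =>
    rw [Finset.prod_range_succ, mul_comm (∏ i ∈ _, _), mul_assoc, ih,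
      one_sub_mul_tsum_sieved hφ hmul]

theorem tendsto_prod_one_sub_mul_tsum (hφ : Summable fun g => ‖φ g‖)
    (hmul : ∀ g g', φ (g + g') = φ g * φ g') (hone : φ 0 = 1) :
    Filter.Tendsto (fun n => (∏ i ∈ Finset.range n, (1 - φ (Finsupp.single i 1))) * ∑' g, φ g)
      Filter.atTop (nhds 1) := by
  simp_rw [prod_one_sub_mul_tsum hφ hmul]
  have h1 : ∑' g, ({0} : Set (ℕ →₀ ℕ)).indicator φ g = 1 := by
    rw [tsum_eq_single 0 fun g hg => Set.indicator_of_notMem (by simpa using hg) _]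
    simp [hone]
  rw [← h1]
  refine tendsto_tsum_of_dominated_convergence hφ (fun g => ?_)
    (Filter.Eventually.of_forall fun n g => norm_indicator_le_norm_self _ _)
  by_cases hg : g = 0
  · subst hg
    have : ∀ n, (0 : ℕ →₀ ℕ) ∈ sievedSet n := fun n j _ => rfl
    simp [this]
  · obtain ⟨j, hj⟩ := Finsupp.ne_iff.1 hg
    refine tendsto_const_nhds.congr' ?_
    filter_upwards [Filter.eventually_gt_atTop j] with n hn
    rw [Set.indicator_of_notMem (by simpa using hg),
      Set.indicator_of_notMem fun h : g ∈ sievedSet n => hj (h j hn)]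

end Sieve

/-- The logarithms of the norms of the prime powers `q i ^ (k + 1)`. -/
noncomputable def primePowLog (q : ℕ → ℝ) (p : ℕ × ℕ) : ℝ := (p.2 + 1) * Real.log (q p.1)

/-- The sum over prime powers representing `log ζ(σ)`. -/
noncomputable def logZetaSum (q : ℕ → ℝ) (σ : ℝ) : ℝ :=
  ∑' p : ℕ × ℕ, Real.exp (-primePowLog q p * σ) / (p.2 + 1)

namespace IsAxiomA

variable {q : ℕ → ℝ} {κ A θ : ℝ}

theorem primePowLog_pos (h : IsAxiomA q κ A θ) (p : ℕ × ℕ) : 0 < primePowLog q p :=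
  mul_pos (by positivity) (Real.log_pos (h.one_lt _))

theorem bNorm_add (q : ℕ → ℝ) (g g' : ℕ →₀ ℕ) : bNorm q (g + g') = bNorm q g * bNorm q g' :=
  Finsupp.prod_add_index' (fun _ => pow_zero _) fun _ _ _ => pow_add _ _ _

theorem bNorm_single (q : ℕ → ℝ) (n : ℕ) : bNorm q (Finsupp.single n 1) = q n := by
  rw [bNorm, Finsupp.prod_single_index (h := fun i k => q i ^ k) (pow_zero _), pow_one]

theorem sum_neg_log_one_sub_le (h : IsAxiomA q κ A θ) {σ : ℝ} (hσ : 1 < σ) (n : ℕ) :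
    ∑ i ∈ Finset.range n, -Real.log (1 - q i ^ (-σ)) ≤ Real.log (σ / (σ - 1) * (A + κ)) := by
  have hs := h.summable_rpow hσ
  have hnn : ∀ g, 0 ≤ bNorm q g ^ (-σ) := fun g => Real.rpow_nonneg (h.bNorm_pos g).le _
  have hx : ∀ i, 0 < 1 - q i ^ (-σ) := fun i =>
    sub_pos.2 (Real.rpow_lt_one_of_one_lt_of_neg (h.one_lt i) (by linarith))
  have h0 := prod_one_sub_mul_tsum (φ := fun g => bNorm q g ^ (-σ)) (by simpa using hs.norm)
    (fun g g' => by
      simp only [bNorm_add]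
      exact Real.mul_rpow (h.bNorm_pos g).le (h.bNorm_pos g').le) n
  simp only [bNorm_single] at h0
  have h1 : 1 ≤ ∑' g, (sievedSet n).indicator (fun g => bNorm q g ^ (-σ)) g := by
    have h2 := (hs.indicator (sievedSet n)).le_tsum 0 fun g _ =>
      Set.indicator_nonneg (fun g _ => hnn g) g
    refine le_trans (le_of_eq ?_) h2
    rw [Set.indicator_of_mem (show (0 : ℕ →₀ ℕ) ∈ sievedSet n from fun j _ => rfl)]
    simp [bNorm]
  have hP : 0 < ∏ i ∈ Finset.range n, (1 - q i ^ (-σ)) := Finset.prod_pos fun i _ => hx i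
  have hZ : 0 < ∑' g, bNorm q g ^ (-σ) := by
    rw [← h0] at h1
    exact pos_of_mul_pos_right (one_pos.trans_le h1) hP.le
  have h2 := Real.log_nonneg h1
  rw [← h0, Real.log_mul hP.ne' hZ.ne', Real.log_prod fun i _ => (hx i).ne'] at h2
  rw [Finset.sum_neg_distrib]
  have := Real.log_le_log hZ (h.tsum_rpow_le hσ)
  linarith

theorem exp_neg_primePowLog (h : IsAxiomA q κ A θ) (σ : ℝ) (i k : ℕ) :
    Real.exp (-primePowLog q (i, k) * σ) = (q i ^ (-σ)) ^ (k + 1) := by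
  rw [Real.rpow_def_of_pos (one_pos.trans (h.one_lt i)), ← Real.exp_nat_mul, primePowLog]
  congr 1
  push_cast
  ring

theorem cexp_neg_primePowLog (h : IsAxiomA q κ A θ) (s : ℂ) (i k : ℕ) :
    Complex.exp (-primePowLog q (i, k) * s) = ((q i : ℂ) ^ (-s)) ^ (k + 1) := by
  have hq : 0 < q i := one_pos.trans (h.one_lt i)
  rw [Complex.cpow_def_of_ne_zero (by exact_mod_cast hq.ne'), ← Complex.exp_nat_mul, primePowLog,
    ← Complex.ofReal_log hq.le]
  congr 1
  push_cast
  ring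

theorem summable_logZetaSum_and_le (h : IsAxiomA q κ A θ) {σ : ℝ} (hσ : 1 < σ) :
    (Summable fun p : ℕ × ℕ => Real.exp (-primePowLog q p * σ) / (p.2 + 1)) ∧
      logZetaSum q σ ≤ Real.log (σ / (σ - 1) * (A + κ)) := by
  have hx0 : ∀ i, 0 < q i ^ (-σ) := fun i => Real.rpow_pos_of_pos (one_pos.trans (h.one_lt i)) _
  have hx1 : ∀ i, q i ^ (-σ) < 1 := fun i =>
    Real.rpow_lt_one_of_one_lt_of_neg (h.one_lt i) (by linarith)
  have hfib : ∀ i, HasSum (fun k : ℕ => Real.exp (-primePowLog q (i, k) * σ) / ((k : ℝ) + 1))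
      (-Real.log (1 - q i ^ (-σ))) := fun i => by
    simp_rw [h.exp_neg_primePowLog]
    exact Real.hasSum_pow_div_log_of_abs_lt_one (by rw [abs_of_pos (hx0 i)]; exact hx1 i)
  have hnn : ∀ i, 0 ≤ -Real.log (1 - q i ^ (-σ)) := fun i =>
    neg_nonneg.2 (Real.log_nonpos (by linarith [hx1 i]) (by linarith [hx0 i]))
  have hs : Summable fun p : ℕ × ℕ => Real.exp (-primePowLog q p * σ) / (p.2 + 1) := by
    refine (summable_prod_of_nonneg fun p => by positivity).2 ⟨fun i => (hfib i).summable, ?_⟩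
    simp_rw [fun i => (hfib i).tsum_eq]
    exact summable_of_sum_range_le hnn (h.sum_neg_log_one_sub_le hσ)
  refine ⟨hs, ?_⟩
  rw [logZetaSum, hs.tsum_prod]
  simp_rw [fun i => (hfib i).tsum_eq]
  exact Real.tsum_le_of_sum_range_le hnn (h.sum_neg_log_one_sub_le hσ)

theorem norm_exp_primePowLog (q : ℕ → ℝ) (s : ℂ) (p : ℕ × ℕ) :
    ‖Complex.exp (-primePowLog q p * s) / ((p.2 : ℂ) + 1)‖ =
      Real.exp (-primePowLog q p * s.re) / (p.2 + 1) := by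
  rw [norm_div, Complex.norm_exp]
  congr 1
  · simp
  · exact_mod_cast Complex.norm_natCast (p.2 + 1)

theorem summable_cexp_primePowLog (h : IsAxiomA q κ A θ) {s : ℂ} (hs : 1 < s.re) :
    Summable fun p : ℕ × ℕ => Complex.exp (-primePowLog q p * s) / ((p.2 : ℂ) + 1) := by
  refine Summable.of_norm ?_
  simp_rw [norm_exp_primePowLog]
  exact (h.summable_logZetaSum_and_le hs).1

theorem bZeta_eq_exp (h : IsAxiomA q κ A θ) {s : ℂ} (hs : 1 < s.re) :
    bZeta q κ s =
      Complex.exp (∑' p : ℕ × ℕ, Complex.exp (-primePowLog q p * s) / ((p.2 : ℂ) + 1)) := by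
  set F := ∑' p : ℕ × ℕ, Complex.exp (-primePowLog q p * s) / ((p.2 : ℂ) + 1) with hF
  have hx : ∀ i, ‖(q i : ℂ) ^ (-s)‖ < 1 := fun i => by
    rw [Complex.norm_cpow_eq_rpow_re_of_pos (one_pos.trans (h.one_lt i))]
    exact Real.rpow_lt_one_of_one_lt_of_neg (h.one_lt i) (by simp; linarith)
  have hfib : ∀ i, HasSum (fun k : ℕ => Complex.exp (-primePowLog q (i, k) * s) / ((k : ℂ) + 1))
      (-Complex.log (1 - (q i : ℂ) ^ (-s))) := fun i => by
    simp_rw [h.cexp_neg_primePowLog]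
    have h1 := (hasSum_nat_add_iff' 1).2 (Complex.hasSum_taylorSeries_neg_log (hx i))
    simpa using h1
  have h1 := ((h.summable_cexp_primePowLog hs).hasSum.prod_fiberwise hfib).tendsto_sum_nat
  have h2 : Filter.Tendsto (fun n => ∏ i ∈ Finset.range n, (1 - (q i : ℂ) ^ (-s))) Filter.atTop
      (nhds (Complex.exp (-F))) := by
    refine ((Complex.continuous_exp.tendsto _).comp h1.neg).congr fun n => ?_
    simp only [Function.comp, Finset.sum_neg_distrib, neg_neg]
    rw [Complex.exp_sum]
    refine Finset.prod_congr rfl fun i _ => Complex.exp_log fun h0 => ?_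
    have := hx i
    rw [← sub_eq_zero.1 h0, norm_one] at this
    exact lt_irrefl _ this
  have h3 := tendsto_prod_one_sub_mul_tsum (φ := fun g => (bNorm q g : ℂ) ^ (-s)) (by
      simp_rw [Complex.norm_cpow_eq_rpow_re_of_pos (h.bNorm_pos _)]
      exact h.summable_rpow hs)
    (fun g g' => by
      simp only [bNorm_add, Complex.ofReal_mul]
      exact Complex.mul_cpow_ofReal_nonneg (h.bNorm_pos g).le (h.bNorm_pos g').le _)
    (by simp [bNorm])
  simp only [bNorm_single, ← h.bZeta_eq_tsum hs] at h3
  have h4 := tendsto_nhds_unique h3 (h2.mul_const _)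
  rw [Complex.exp_neg] at h4
  have h5 := Complex.exp_ne_zero F
  field_simp at h4
  exact h4.symm

theorem bZeta_ne_zero (h : IsAxiomA q κ A θ) {s : ℂ} (hs : 1 < s.re) : bZeta q κ s ≠ 0 := by
  rw [h.bZeta_eq_exp hs]
  exact Complex.exp_ne_zero _

theorem hasSum_log_norm_bZeta (h : IsAxiomA q κ A θ) {σ : ℝ} (hσ : 1 < σ) (t : ℝ) :
    HasSum (fun p : ℕ × ℕ => Real.exp (-primePowLog q p * σ) / (p.2 + 1) *
      Real.cos (primePowLog q p * t)) (Real.log ‖bZeta q κ ⟨σ, t⟩‖) := by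
  have hs : 1 < (⟨σ, t⟩ : ℂ).re := hσ
  rw [h.bZeta_eq_exp hs, Complex.norm_exp, Real.log_exp]
  convert Complex.hasSum_re (h.summable_cexp_primePowLog hs).hasSum using 2 with p
  have : ((p.2 : ℂ) + 1) = ((p.2 + 1 : ℝ) : ℂ) := by push_cast; rfl
  rw [this, Complex.div_ofReal_re, Complex.exp_re]
  simp [div_mul_eq_mul_div]

theorem abs_log_norm_bZeta_le (h : IsAxiomA q κ A θ) {σ : ℝ} (hσ : 1 < σ) (t : ℝ) :
    |Real.log ‖bZeta q κ ⟨σ, t⟩‖| ≤ logZetaSum q σ := by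
  have h1 := h.hasSum_log_norm_bZeta hσ t
  have h2 := (h.summable_logZetaSum_and_le hσ).1
  rw [← h1.tsum_eq, ← Real.norm_eq_abs]
  refine tsum_of_norm_bounded h2.hasSum fun p => ?_
  rw [norm_mul, Real.norm_of_nonneg (by positivity)]
  exact mul_le_of_le_one_right (by positivity) (Real.abs_cos_le_one _)

theorem norm_bZeta_inv_le (h : IsAxiomA q κ A θ) (hA : 1 ≤ A + κ) {s : ℂ} (hs : 1 < s.re) :
    ‖(bZeta q κ s)⁻¹‖ ≤ s.re / (s.re - 1) * (A + κ) := by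
  have h1 := (abs_le.1 (h.abs_log_norm_bZeta_le hs s.im)).1
  have h2 := (h.summable_logZetaSum_and_le hs).2
  have h3 : 0 < s.re / (s.re - 1) * (A + κ) :=
    mul_pos (div_pos (by linarith) (by linarith)) (by linarith)
  have h4 : 0 < ‖bZeta q κ s‖ := norm_pos_iff.2 (h.bZeta_ne_zero hs)
  rw [norm_inv, ← Real.log_le_log_iff (inv_pos.2 h4) h3, Real.log_inv]
  linarith

theorem abs_integral_cos_le {ℓ : ℝ} (hℓ : 0 < ℓ) (R T : ℝ) :
    |∫ t in R..T, Real.cos (ℓ * t)| ≤ 2 / ℓ := by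
  rw [intervalIntegral.integral_comp_mul_left (fun t => Real.cos t) hℓ.ne', integral_cos,
    smul_eq_mul, abs_mul, abs_of_pos (inv_pos.2 hℓ), div_eq_inv_mul]
  gcongr
  rw [abs_le]
  constructor <;>
    linarith [Real.sin_le_one (ℓ * T), Real.neg_one_le_sin (ℓ * T), Real.sin_le_one (ℓ * R),
      Real.neg_one_le_sin (ℓ * R)]

theorem continuous_log_norm_bZeta (h : IsAxiomA q κ A θ) {σ : ℝ} (hσ : 1 < σ) :
    Continuous fun t => Real.log ‖bZeta q κ ⟨σ, t⟩‖ := by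
  refine Continuous.log (continuous_iff_continuousAt.2 fun t => ?_) fun t =>
    norm_ne_zero_iff.2 (h.bZeta_ne_zero hσ)
  have h1 : ContinuousAt (bZeta q κ) (⟨σ, t⟩ : ℂ) :=
    (h.differentiableAt_bZeta (s := ⟨σ, t⟩) hσ).continuousAt
  have h2 : Continuous fun t : ℝ => (⟨σ, t⟩ : ℂ) := by
    simp_rw [Complex.mk_eq_add_mul_I]
    fun_prop
  exact (ContinuousAt.comp (f := fun t : ℝ => (⟨σ, t⟩ : ℂ)) h1 h2.continuousAt).norm

theorem hasSum_log_norm_sub (h : IsAxiomA q κ A θ) {σ σ' : ℝ} (hσ : 1 < σ) (hσσ' : σ ≤ σ')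
    (t : ℝ) :
    HasSum (fun p : ℕ × ℕ => (Real.exp (-primePowLog q p * σ) -
      Real.exp (-primePowLog q p * σ')) / (p.2 + 1) * Real.cos (primePowLog q p * t))
      (Real.log ‖bZeta q κ ⟨σ, t⟩‖ - Real.log ‖bZeta q κ ⟨σ', t⟩‖) := by
  have h1 := (h.hasSum_log_norm_bZeta hσ t).sub
    (h.hasSum_log_norm_bZeta (hσ.trans_le hσσ') t)
  simpa only [sub_div, sub_mul] using h1

theorem exp_sub_exp_div_nonneg (h : IsAxiomA q κ A θ) {σ σ' : ℝ} (hσσ' : σ ≤ σ') (p : ℕ × ℕ) :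
    0 ≤ (Real.exp (-primePowLog q p * σ) - Real.exp (-primePowLog q p * σ')) / (p.2 + 1) := by
  refine div_nonneg (sub_nonneg.2 (Real.exp_le_exp.2 ?_)) (by positivity)
  have := mul_le_mul_of_nonneg_left hσσ' (h.primePowLog_pos p).le
  linarith

theorem norm_exp_sub_exp_mul_cos_le (h : IsAxiomA q κ A θ) {σ σ' : ℝ} (hσσ' : σ ≤ σ') (t : ℝ)
    (p : ℕ × ℕ) :
    ‖(Real.exp (-primePowLog q p * σ) - Real.exp (-primePowLog q p * σ')) / (p.2 + 1) *
      Real.cos (primePowLog q p * t)‖ ≤ Real.exp (-primePowLog q p * σ) / (p.2 + 1) := by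
  have h0 := h.exp_sub_exp_div_nonneg hσσ' p
  rw [norm_mul, Real.norm_of_nonneg h0]
  refine (mul_le_of_le_one_right h0 (Real.abs_cos_le_one _)).trans ?_
  gcongr
  linarith [Real.exp_pos (-primePowLog q p * σ')]

theorem abs_log_norm_sub_le (h : IsAxiomA q κ A θ) {σ σ' : ℝ} (hσ : 1 < σ) (hσσ' : σ ≤ σ')
    (t : ℝ) :
    |Real.log ‖bZeta q κ ⟨σ, t⟩‖ - Real.log ‖bZeta q κ ⟨σ', t⟩‖| ≤ logZetaSum q σ := by
  rw [← (h.hasSum_log_norm_sub hσ hσσ' t).tsum_eq, ← Real.norm_eq_abs]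
  exact tsum_of_norm_bounded (h.summable_logZetaSum_and_le hσ).1.hasSum
    (h.norm_exp_sub_exp_mul_cos_le hσσ' t)

/-- The difference of `log |ζ|` on two vertical lines has bounded integrals. -/
theorem abs_integral_log_norm_sub_le (h : IsAxiomA q κ A θ) {σ σ' : ℝ} (hσ : 1 < σ)
    (hσσ' : σ ≤ σ') (R T : ℝ) :
    |∫ t in R..T, (Real.log ‖bZeta q κ ⟨σ, t⟩‖ - Real.log ‖bZeta q κ ⟨σ', t⟩‖)| ≤
      2 * (σ' - σ) * logZetaSum q σ := by
  have hs := (h.summable_logZetaSum_and_le hσ).1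
  have hsum := intervalIntegral.hasSum_integral_of_dominated_convergence (μ := MeasureTheory.volume)
    (a := R) (b := T)
    (F := fun p t => (Real.exp (-primePowLog q p * σ) - Real.exp (-primePowLog q p * σ')) /
      (p.2 + 1) * Real.cos (primePowLog q p * t))
    (fun p _ => Real.exp (-primePowLog q p * σ) / (p.2 + 1))
    (fun p => Continuous.aestronglyMeasurable (by fun_prop))
    (fun p => Filter.Eventually.of_forall fun t _ => h.norm_exp_sub_exp_mul_cos_le hσσ' t p)
    (Filter.Eventually.of_forall fun t _ => hs)
    intervalIntegrable_const
    (Filter.Eventually.of_forall fun t _ => h.hasSum_log_norm_sub hσ hσσ' t)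
  rw [← hsum.tsum_eq, ← Real.norm_eq_abs]
  refine tsum_of_norm_bounded (hs.hasSum.mul_left (2 * (σ' - σ))) fun p => ?_
  have hl := h.primePowLog_pos p
  have h0 := h.exp_sub_exp_div_nonneg hσσ' p
  have h2 : Real.exp (-primePowLog q p * σ') =
      Real.exp (-primePowLog q p * σ) * Real.exp (-primePowLog q p * (σ' - σ)) := by
    rw [← Real.exp_add]; congr 1; ring
  have h3 : (Real.exp (-primePowLog q p * σ) - Real.exp (-primePowLog q p * σ')) / (p.2 + 1) ≤
      primePowLog q p * (σ' - σ) * (Real.exp (-primePowLog q p * σ) / (p.2 + 1)) := by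
    rw [h2, ← mul_div_assoc]
    gcongr
    nlinarith [Real.exp_pos (-primePowLog q p * σ),
      Real.add_one_le_exp (-primePowLog q p * (σ' - σ))]
  rw [intervalIntegral.integral_const_mul, norm_mul, Real.norm_of_nonneg h0]
  calc _ ≤ _ := mul_le_mul_of_nonneg_left (abs_integral_cos_le hl R T) h0
    _ ≤ _ := mul_le_mul_of_nonneg_right h3 (by positivity)
    _ = _ := by field_simp

end IsAxiomA

/-! ### The zero-detecting inequality at a single height -/

/-- The auxiliary function to which the strip form of Jensen's formula is applied. -/
noncomputable def bAux (q : ℕ → ℝ) (κ a t : ℝ) (s : ℂ) : ℂ :=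
  bZetaReg q κ s / (s + 1) * (bZeta q κ (2 * (a + 3) - s))⁻¹ *
    Complex.exp ((s - ⟨a + 3 / 2, t⟩) ^ 2 / (4 * t))

namespace IsAxiomA

variable {q : ℕ → ℝ} {κ A θ : ℝ}

theorem add_one_ne_zero_of_re_pos {s : ℂ} (hs : 0 < s.re) : s + 1 ≠ 0 := fun h0 => by
  have := congrArg Complex.re h0
  simp only [Complex.add_re, Complex.one_re, Complex.zero_re] at this
  linarith

theorem re_reflect (a : ℝ) (s : ℂ) : (2 * ((a : ℂ) + 3) - s).re = 2 * (a + 3) - s.re := by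
  simp

theorem norm_gaussian (a t : ℝ) (s : ℂ) :
    ‖Complex.exp ((s - ⟨a + 3 / 2, t⟩) ^ 2 / (4 * t))‖ =
      Real.exp (((s.re - (a + 3 / 2)) ^ 2 - (s.im - t) ^ 2) / (4 * t)) := by
  rw [Complex.norm_exp]
  congr 1
  have : (4 * (t : ℂ)) = ((4 * t : ℝ) : ℂ) := by push_cast; rfl
  rw [this, Complex.div_ofReal_re]
  congr 1
  simp only [sq, Complex.mul_re, Complex.sub_re, Complex.sub_im]

theorem differentiableAt_bAux (h : IsAxiomA q κ A θ) {a t : ℝ} (ha : θ < a) {s : ℂ}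
    (hs1 : a ≤ s.re) (hs2 : s.re ≤ a + 3) : DifferentiableAt ℂ (bAux q κ a t) s := by
  have hθ := h.theta_pos
  have h1 := h.differentiableAt_bZetaReg (ha.trans_le hs1)
  have h2 : s + 1 ≠ 0 := add_one_ne_zero_of_re_pos (by linarith)
  have h3 : 1 < (2 * ((a : ℂ) + 3) - s).re := by rw [re_reflect]; linarith
  have h4 := h.bZeta_ne_zero h3
  have h5 : DifferentiableAt ℂ (fun z => bZeta q κ (2 * ((a : ℂ) + 3) - z)) s :=
    DifferentiableAt.comp (g := bZeta q κ) (f := fun z => 2 * ((a : ℂ) + 3) - z) s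
      (h.differentiableAt_bZeta h3) (by fun_prop)
  have h6 : DifferentiableAt ℂ
      (fun z => Complex.exp ((z - ⟨a + 3 / 2, t⟩) ^ 2 / (4 * t))) s := by fun_prop
  exact ((h1.div (by fun_prop) h2).mul (h5.inv h4)).mul h6

theorem norm_bZetaReg_div_le (h : IsAxiomA q κ A θ) {δ : ℝ} (hδ : 0 < δ) (hδ1 : δ ≤ 1) {s : ℂ}
    (hs : θ + δ ≤ s.re) {B : ℝ} (hB1 : 1 ≤ B) (hB : ‖s - 1‖ ≤ B) :
    ‖bZetaReg q κ s / (s + 1)‖ ≤ (A + κ) / δ * B := by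
  have hθ := h.theta_pos
  have hκ := h.kappa_pos
  have hA := h.A_pos
  have hint := h.norm_bInt_le (s := s) (by linarith)
  have hint2 : ‖bInt q κ s‖ ≤ A / δ := hint.trans (by gcongr; linarith)
  have hs1 : ‖s‖ ≤ ‖s + 1‖ := by
    rw [Complex.norm_def, Complex.norm_def]
    refine Real.sqrt_le_sqrt ?_
    simp only [Complex.normSq_apply, Complex.add_re, Complex.add_im, Complex.one_re,
      Complex.one_im]
    nlinarith
  have hs2 : 1 ≤ ‖s + 1‖ := by
    refine le_trans ?_ (Complex.re_le_norm _)
    simp only [Complex.add_re, Complex.one_re]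
    linarith
  rw [norm_div, div_le_iff₀ (by linarith), bZetaReg]
  have h1 : κ ≤ κ / δ * B * ‖s + 1‖ := by
    have : κ ≤ κ / δ := le_div_self hκ.le hδ hδ1
    calc κ ≤ κ / δ := this
      _ ≤ κ / δ * B := le_mul_of_one_le_right (by positivity) hB1
      _ ≤ _ := le_mul_of_one_le_right (by positivity) hs2
  calc ‖(κ : ℂ) + (s - 1) * s * bInt q κ s‖ ≤ ‖(κ : ℂ)‖ + ‖s - 1‖ * ‖s‖ * ‖bInt q κ s‖ := by
        refine (norm_add_le _ _).trans ?_
        rw [norm_mul, norm_mul]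
    _ ≤ κ / δ * B * ‖s + 1‖ + B * ‖s + 1‖ * (A / δ) := by
        rw [Complex.norm_real, Real.norm_of_nonneg hκ.le]
        gcongr
    _ = _ := by ring

theorem norm_bAux_le (h : IsAxiomA q κ A θ) {δ t m M : ℝ} (hδ : 0 < δ) (hδ1 : δ ≤ 1)
    (ht : 1 ≤ t) (hm : 0 ≤ m) {s : ℂ} (hs1 : θ + δ ≤ s.re) (hs2 : s.re ≤ θ + δ + 3)
    (hsm : |s.re - 1| ≤ m) (hM : ‖(bZeta q κ (2 * ((θ + δ : ℝ) + 3) - s))⁻¹‖ ≤ M) :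
    ‖bAux q κ (θ + δ) t s‖ ≤ (A + κ) / δ * M * t * Real.exp ((m + 1.5625) / t) := by
  have hκ := h.kappa_pos
  have hA := h.A_pos
  have ht0 : 0 < t := by linarith
  have hM0 : 0 ≤ M := (norm_nonneg _).trans hM
  set y := s.im - t with hy
  have h1 : ‖s - 1‖ ≤ m + t + |y| := by
    refine (Complex.norm_le_abs_re_add_abs_im _).trans ?_
    simp only [Complex.sub_re, Complex.sub_im, Complex.one_re, Complex.one_im, sub_zero]
    have : |s.im| ≤ |t| + |y| := by
      have := abs_add_le t y
      rwa [show t + y = s.im by rw [hy]; ring] at this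
    rw [abs_of_pos ht0] at this
    linarith
  have h2 := h.norm_bZetaReg_div_le hδ hδ1 hs1
    (by linarith [abs_nonneg y] : 1 ≤ m + t + |y|) h1
  have h3 : m + t + |y| ≤ t * Real.exp ((m + |y|) / t) := by
    have := Real.add_one_le_exp ((m + |y|) / t)
    calc m + t + |y| = t * ((m + |y|) / t + 1) := by field_simp; ring
      _ ≤ _ := by gcongr
  rw [bAux, norm_mul, norm_mul, norm_gaussian]
  calc _ ≤ (A + κ) / δ * (t * Real.exp ((m + |y|) / t)) * M *
        Real.exp (((s.re - (θ + δ + 3 / 2)) ^ 2 - y ^ 2) / (4 * t)) := by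
        gcongr
        exact h2.trans (by gcongr)
    _ = (A + κ) / δ * M * t * Real.exp ((m + |y|) / t +
        ((s.re - (θ + δ + 3 / 2)) ^ 2 - y ^ 2) / (4 * t)) := by
        rw [Real.exp_add]; ring
    _ ≤ _ := by
        gcongr
        rw [← sub_nonneg]
        have h4 : (m + 1.5625) / t - ((m + |y|) / t +
            ((s.re - (θ + δ + 3 / 2)) ^ 2 - y ^ 2) / (4 * t)) =
            ((9 / 4 - (s.re - (θ + δ + 3 / 2)) ^ 2) + (|y| - 2) ^ 2) / (4 * t) := by
          field_simp
          rw [← sq_abs y]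
          ring
        rw [h4]
        refine div_nonneg (add_nonneg ?_ (sq_nonneg _)) (by linarith)
        nlinarith

theorem norm_bAux_right (h : IsAxiomA q κ A θ) {a t : ℝ} (ha : 0 < a) (ht : 0 < t) {s : ℂ}
    (hs : s.re = a + 3) : ‖bAux q κ a t s‖ ≤ Real.exp (0.5625 / t) := by
  have hs1 : 1 < s.re := by linarith
  have hconj : 2 * ((a : ℂ) + 3) - s = (starRingEnd ℂ) s := by
    apply Complex.ext <;> simp [hs]; ring
  have hne : s ≠ 1 := by rintro rfl; simp at hs1
  have hz := norm_pos_iff.2 (h.bZeta_ne_zero hs1)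
  have h2 : 0 < ‖s + 1‖ := norm_pos_iff.2 (add_one_ne_zero_of_re_pos (by linarith))
  have h3 : ‖s - 1‖ ≤ ‖s + 1‖ := by
    rw [Complex.norm_def, Complex.norm_def]
    refine Real.sqrt_le_sqrt ?_
    simp only [Complex.normSq_apply, Complex.add_re, Complex.add_im, Complex.sub_re,
      Complex.sub_im, Complex.one_re, Complex.one_im]
    nlinarith
  rw [bAux, hconj, bZeta_conj, bZetaReg_eq hne, norm_mul, norm_gaussian, norm_mul, norm_div,
    norm_mul, norm_inv, RCLike.norm_conj]
  have h4 : ‖s - 1‖ * ‖bZeta q κ s‖ / ‖s + 1‖ * ‖bZeta q κ s‖⁻¹ ≤ 1 := by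
    rw [show ‖s - 1‖ * ‖bZeta q κ s‖ / ‖s + 1‖ * ‖bZeta q κ s‖⁻¹ = ‖s - 1‖ / ‖s + 1‖ by
      field_simp]
    exact (div_le_one h2).2 h3
  calc _ ≤ 1 * Real.exp (((s.re - (a + 3 / 2)) ^ 2 - (s.im - t) ^ 2) / (4 * t)) := by gcongr
    _ ≤ _ := by
        rw [one_mul, Real.exp_le_exp, hs, div_le_div_iff₀ (by linarith) ht]
        nlinarith [sq_nonneg (s.im - t)]

theorem log_norm_bAux_center (h : IsAxiomA q κ A θ) {a t : ℝ} (ha : 0 < a) (ha1 : a < 1)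
    (ht : 5 ≤ t) :
    bAux q κ a t ⟨a + 3 / 2, t⟩ ≠ 0 ∧ -2 * Real.log ‖bAux q κ a t ⟨a + 3 / 2, t⟩‖ ≤
      2 / t - 2 * (Real.log ‖bZeta q κ ⟨a + 3 / 2, t⟩‖ -
        Real.log ‖bZeta q κ ⟨a + 9 / 2, t⟩‖) := by
  set c : ℂ := ⟨a + 3 / 2, t⟩ with hc
  have hc1 : 1 < c.re := by simp only [hc]; linarith
  have hne : c - 1 ≠ 0 := sub_ne_zero.2 (by intro h0; rw [h0] at hc1; simp at hc1)
  have h2 : c + 1 ≠ 0 := add_one_ne_zero_of_re_pos (by linarith)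
  have hconj : 2 * ((a : ℂ) + 3) - c = (starRingEnd ℂ) ⟨a + 9 / 2, t⟩ := by
    apply Complex.ext <;> simp [hc]; ring
  have hz := h.bZeta_ne_zero hc1
  have hz2 : bZeta q κ ⟨a + 9 / 2, t⟩ ≠ 0 :=
    h.bZeta_ne_zero (by show (1 : ℝ) < a + 9 / 2; linarith)
  have hval : ‖bAux q κ a t c‖ =
      ‖c - 1‖ * ‖bZeta q κ c‖ / ‖c + 1‖ * ‖bZeta q κ ⟨a + 9 / 2, t⟩‖⁻¹ := by
    rw [bAux, hconj, bZeta_conj, bZetaReg_eq (sub_ne_zero.1 hne), ← hc, sub_self]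
    simp only [norm_mul, norm_div, norm_inv, RCLike.norm_conj]
    simp
  have p1 := norm_pos_iff.2 hne
  have p2 := norm_pos_iff.2 h2
  have p3 := norm_pos_iff.2 hz
  have p4 := norm_pos_iff.2 hz2
  refine ⟨norm_pos_iff.1 (by rw [hval]; positivity), ?_⟩
  rw [hval, Real.log_mul (by positivity) (by positivity), Real.log_div (by positivity) p2.ne',
    Real.log_mul p1.ne' p3.ne', Real.log_inv]
  have hkey : 2 * Real.log ‖c + 1‖ - 2 * Real.log ‖c - 1‖ ≤ 2 / t := by
    have e1 : ∀ z : ℂ, 2 * Real.log ‖z‖ = Real.log (Complex.normSq z) := fun z => by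
      rw [Complex.normSq_eq_norm_sq, Real.log_pow]; norm_num
    rw [e1, e1]
    have q1 := Complex.normSq_pos.2 hne
    have q2 := Complex.normSq_pos.2 h2
    rw [← Real.log_div q2.ne' q1.ne']
    refine (Real.log_le_sub_one_of_pos (div_pos q2 q1)).trans ?_
    rw [sub_le_iff_le_add, div_le_iff₀ q1]
    simp only [hc, Complex.normSq_apply, Complex.add_re, Complex.add_im, Complex.sub_re,
      Complex.sub_im, Complex.one_re, Complex.one_im]
    have ht0 : 0 < t := by linarith
    have e2 : 2 / t * ((a + 3 / 2 - 1) * (a + 3 / 2 - 1) + (t - 0) * (t - 0)) ≥ 2 * t := by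
      have : 2 / t * ((a + 3 / 2 - 1) * (a + 3 / 2 - 1) + (t - 0) * (t - 0)) =
        2 * t + 2 / t * (a + 1 / 2) ^ 2 := by field_simp; ring
      rw [this]
      have : 0 ≤ 2 / t * (a + 1 / 2) ^ 2 := by positivity
      linarith
    nlinarith
  linarith

/-- A sum over zeros near the height `t` is bounded by local data of the zeta function. -/
theorem sum_zeros_le_at_height (h : IsAxiomA q κ A θ) (hA1 : 1 ≤ A + κ) {η t : ℝ} (hη : 0 < η)
    (hη1 : θ + η < 1) (ht : 5 ≤ t) (Z : Finset ℂ)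
    (hZ : ∀ ρ ∈ Z, ρ ≠ 1 ∧ θ + η ≤ ρ.re ∧ bZeta q κ ρ = 0) :
    ∑ ρ ∈ Z, π * η / 2 / Real.cosh (π / 3 * (t - ρ.im)) ≤
      Real.log (9.6 * (A + κ) ^ 2 * t / η) + 5.125 / t -
        2 * (Real.log ‖bZeta q κ ⟨θ + η / 8 + 3 / 2, t⟩‖ -
          Real.log ‖bZeta q κ ⟨θ + η / 8 + 9 / 2, t⟩‖) := by
  have hθ := h.theta_pos
  have hAκ : 0 < A + κ := by linarith
  have ht0 : 0 < t := by linarith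
  have hre : ∀ ρ ∈ Z, ρ.re ≤ 1 := fun ρ hρ => by
    by_contra! h1
    exact h.bZeta_ne_zero h1 (hZ ρ hρ).2.2
  obtain ⟨hc0, hc⟩ := h.log_norm_bAux_center (a := θ + η / 8) (by linarith) (by linarith) ht
  have hrefl : ∀ s : ℂ, s.re ≤ θ + η / 8 + 3 → ∀ r : ℝ, 1 < r →
      r ≤ 2 * (θ + η / 8 + 3) - s.re →
      ‖(bZeta q κ (2 * ((θ + η / 8 : ℝ) + 3) - s))⁻¹‖ ≤ r / (r - 1) * (A + κ) := by
    intro s hs r hr1 hr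
    have h1 := re_reflect (θ + η / 8) s
    refine (h.norm_bZeta_inv_le hA1 (by rw [h1]; linarith)).trans ?_
    rw [h1]
    gcongr ?_ * _
    rw [div_le_div_iff₀ (by linarith) (by linarith)]
    nlinarith
  have hJ := strip_jensen (l := θ + η / 8) (P := 3 / 2)
    (Ml := 9.6 * (A + κ) ^ 2 * t / η * Real.exp (2.5625 / t)) (Mr := Real.exp (0.5625 / t))
    (by norm_num) (by positivity) (Real.exp_pos _) Z (bAux q κ (θ + η / 8) t)
    (fun z hz1 hz2 => h.differentiableAt_bAux (by linarith) hz1 (by linarith))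
    ⟨_, fun z hz1 hz2 => h.norm_bAux_le (δ := η / 8) (m := 3) (by linarith) (by linarith)
      (by linarith) (by norm_num) hz1 (by linarith) (abs_le.2 ⟨by linarith, by linarith⟩)
      (hrefl z (by linarith) 3 (by norm_num) (by linarith))⟩
    (fun z hz => by
      refine (h.norm_bAux_le (δ := η / 8) (t := t) (m := 1) (by linarith) (by linarith)
        (by linarith) (by norm_num) hz.ge (by linarith) (abs_le.2 ⟨by linarith, by linarith⟩)
        (hrefl z (by linarith) 6 (by norm_num) (by linarith))).trans (le_of_eq ?_)
      norm_num
      field_simp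
      norm_num)
    (fun z hz => h.norm_bAux_right (by linarith) ht0 (by rw [hz]; ring))
    (fun ρ hρ => ⟨by linarith [(hZ ρ hρ).2.1], by linarith [hre ρ hρ], by
      rw [bAux, bZetaReg_eq (hZ ρ hρ).1, (hZ ρ hρ).2.2]; simp⟩)
    (c := ⟨θ + η / 8 + 3 / 2, t⟩) rfl hc0
  rw [Real.log_mul (by positivity) (Real.exp_pos _).ne', Real.log_exp, Real.log_exp] at hJ
  have hsum : ∑ ρ ∈ Z, π * η / 2 / Real.cosh (π / 3 * (t - ρ.im)) ≤
      ∑ ρ ∈ Z, 2 * (Real.sin (π / (2 * (3 / 2)) * (ρ.re - (θ + η / 8))) /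
        Real.cosh (π / (2 * (3 / 2)) * (t - ρ.im))) := by
    refine Finset.sum_le_sum fun ρ hρ => ?_
    rw [show (2 : ℝ) * (3 / 2) = 3 by norm_num, ← mul_div_assoc]
    have hpi := Real.pi_pos
    have hpi4 := Real.pi_lt_d4
    have hcosh := Real.cosh_pos (π / 3 * (t - ρ.im))
    gcongr
    set x := π / 3 * (7 * η / 8) with hx
    have hx0 : 0 < x := by positivity
    have hx1 : x ≤ 0.92 := by
      rw [hx]
      have : η < 1 := by linarith
      nlinarith
    have h1 : Real.sin x ≤ Real.sin (π / 3 * (ρ.re - (θ + η / 8))) := by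
      refine Real.sin_le_sin_of_le_of_le_pi_div_two (by linarith) ?_ ?_
      · have := hre ρ hρ
        nlinarith
      · rw [hx]
        gcongr
        linarith [(hZ ρ hρ).2.1]
    have h2 := Real.sin_gt_sub_cube hx0
    have h3 : π * η / 2 = 12 / 7 * x := by rw [hx]; ring
    rw [h3]
    have h4 : x ^ 3 ≤ 6 / 7 * x := by
      have : x ^ 2 ≤ 6 / 7 := by nlinarith
      calc x ^ 3 = x ^ 2 * x := by ring
        _ ≤ _ := by gcongr
    linarith
  have e : (2.5625 : ℝ) / t + 0.5625 / t + 2 / t = 5.125 / t := by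
    rw [← add_div, ← add_div]; norm_num
  linarith

end IsAxiomA

/-! ### Integration over the heights -/

theorem pi_div_two_le_arctan_sinh_add {y : ℝ} (hy : 0 ≤ y) :
    π / 2 ≤ Real.arctan (Real.sinh y) + π / 2 / Real.cosh y := by
  set x := π / 2 - Real.arctan (Real.sinh y) with hx
  have h1 : Real.sin x = 1 / Real.cosh y := by
    rw [hx, Real.sin_pi_div_two_sub, Real.cos_arctan, add_comm, ← Real.cosh_sq,
      Real.sqrt_sq (Real.cosh_pos y).le]
  have h2 : 0 ≤ Real.arctan (Real.sinh y) := by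
    rw [← Real.arctan_zero]
    exact Real.arctan_mono (Real.sinh_nonneg_iff.2 hy)
  have h3 := Real.mul_le_sin (x := x) (by linarith [Real.arctan_lt_pi_div_two (Real.sinh y)])
    (by linarith)
  have h4 := mul_le_mul_of_nonneg_left h3 (by positivity : 0 ≤ π / 2)
  rw [h1] at h4
  have h5 : π / 2 * (2 / π * x) = x := by field_simp
  have h6 : π / 2 * (1 / Real.cosh y) = π / 2 / Real.cosh y := by ring
  linarith

theorem continuous_inv_cosh (c γ : ℝ) : Continuous fun t => 1 / Real.cosh (c * (t - γ)) :=
  continuous_const.div (by fun_prop) fun t => (Real.cosh_pos _).ne'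

theorem integral_inv_cosh {c : ℝ} (hc : 0 < c) (γ R T : ℝ) :
    ∫ t in R..T, 1 / Real.cosh (c * (t - γ)) =
      (Real.arctan (Real.sinh (c * (T - γ))) - Real.arctan (Real.sinh (c * (R - γ)))) / c := by
  rw [sub_div]
  refine intervalIntegral.integral_eq_sub_of_hasDerivAt
    (f := fun t => Real.arctan (Real.sinh (c * (t - γ))) / c) (fun t _ => ?_)
    ((continuous_inv_cosh c γ).intervalIntegrable _ _)
  have h1 : HasDerivAt (fun t => c * (t - γ)) c t := by
    simpa using ((hasDerivAt_id t).sub_const γ).const_mul c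
  have h2 := ((h1.sinh).arctan).div_const c
  refine h2.congr_deriv ?_
  rw [add_comm, ← Real.cosh_sq]
  have := (Real.cosh_pos (c * (t - γ))).ne'
  field_simp

/-- The integral of the kernel over an interval containing its center, with boundary terms. -/
theorem pi_div_le_integral_inv_cosh_add {c γ R T : ℝ} (hc : 0 < c) (hR : R ≤ γ) (hT : γ ≤ T) :
    π / c ≤ (∫ t in R..T, 1 / Real.cosh (c * (t - γ))) +
      π / (2 * c) * (1 / Real.cosh (c * (R - γ)) + 1 / Real.cosh (c * (T - γ))) := by
  have h1 := pi_div_two_le_arctan_sinh_add (mul_nonneg hc.le (sub_nonneg.2 hT))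
  have h2 := pi_div_two_le_arctan_sinh_add (mul_nonneg hc.le (sub_nonneg.2 hR))
  rw [show c * (γ - R) = -(c * (R - γ)) by ring, Real.sinh_neg, Real.arctan_neg,
    Real.cosh_neg] at h2
  rw [integral_inv_cosh hc]
  have h3 := div_le_div_of_nonneg_right (add_le_add h1 h2) hc.le
  calc π / c = (π / 2 + π / 2) / c := by ring
    _ ≤ _ := h3
    _ = _ := by field_simp; ring

namespace IsAxiomA

variable {q : ℕ → ℝ} {κ A θ : ℝ}

theorem card_zeros_mul_le (h : IsAxiomA q κ A θ) (hA1 : 1 ≤ A + κ) {η R T : ℝ} (hη : 0 < η)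
    (hη1 : θ + η < 1) (hR : 5 ≤ R) (hRT : R ≤ T) (Z : Finset ℂ)
    (hZ : ∀ ρ ∈ Z, ρ ≠ 1 ∧ θ + η ≤ ρ.re ∧ bZeta q κ ρ = 0) (hI : ∀ ρ ∈ Z, R ≤ ρ.im ∧ ρ.im ≤ T) :
    Z.card * (3 / 2 * π * η) ≤
      (T - R) * Real.log (9.6 * (A + κ) ^ 2 * T / η) + 5.125 * Real.log (T / R) +
        3 * Real.log (9.6 * (A + κ) ^ 2 * T / η) + 3.075 + 18 * Real.log (3 * (A + κ)) := by
  have hθ := h.theta_pos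
  have hAκ : 0 < A + κ := by linarith
  have hT : 0 < T := by linarith
  set p := θ + η / 8 + 3 / 2 with hp
  set p' := θ + η / 8 + 9 / 2 with hp'
  set V := Real.log (9.6 * (A + κ) ^ 2 * T / η) with hV
  set D : ℝ → ℝ := fun t => Real.log ‖bZeta q κ ⟨p, t⟩‖ - Real.log ‖bZeta q κ ⟨p', t⟩‖ with hD
  have hp1 : 1 < p := by linarith
  have hpp : p ≤ p' := by linarith
  have hB : logZetaSum q p ≤ Real.log (3 * (A + κ)) := by
    refine (h.summable_logZetaSum_and_le hp1).2.trans (Real.log_le_log ?_ ?_)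
    · have : 0 < p - 1 := by linarith
      positivity
    · gcongr
      rw [div_le_iff₀ (by linarith)]
      linarith
  set S : ℝ → ℝ := fun t => ∑ ρ ∈ Z, π * η / 2 * (1 / Real.cosh (π / 3 * (t - ρ.im))) with hS
  have hU : ∀ t, R ≤ t → t ≤ T → S t ≤ V + 5.125 * (1 / t) - 2 * D t := by
    intro t h1 h2
    have h3 := h.sum_zeros_le_at_height hA1 hη hη1 (hR.trans h1) Z hZ
    have h4 : Real.log (9.6 * (A + κ) ^ 2 * t / η) ≤ V :=
      Real.log_le_log (by have : 0 < t := by linarith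
                          positivity) (by gcongr)
    simp only [hS, hD]
    simp_rw [mul_one_div]
    linarith
  have hDle : ∀ t, -logZetaSum q p ≤ D t := fun t => (abs_le.1 (h.abs_log_norm_sub_le hp1 hpp t)).1
  have hSR := hU R le_rfl hRT
  have hST := hU T hRT le_rfl
  have hDc : Continuous D :=
    (h.continuous_log_norm_bZeta hp1).sub (h.continuous_log_norm_bZeta (hp1.trans_le hpp))
  have hSc : Continuous S :=
    continuous_finsetSum _ fun ρ _ => continuous_const.mul (continuous_inv_cosh _ _)
  have hinv : IntervalIntegrable (fun t : ℝ => 1 / t) MeasureTheory.volume R T := by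
    refine intervalIntegral.intervalIntegrable_one_div (fun t ht => ?_) continuousOn_id
    rw [Set.uIcc_of_le hRT] at ht
    exact (by linarith [ht.1] : (0 : ℝ) < t).ne'
  have hint : ∫ t in R..T, S t ≤ (T - R) * V + 5.125 * Real.log (T / R) - 2 * ∫ t in R..T, D t := by
    refine (intervalIntegral.integral_mono_on hRT (hSc.intervalIntegrable _ _)
      ((intervalIntegrable_const.add (hinv.const_mul _)).sub
        ((hDc.intervalIntegrable _ _).const_mul _)) fun t ht => hU t ht.1 ht.2).trans
        (le_of_eq ?_)
    rw [intervalIntegral.integral_sub (intervalIntegrable_const.add (hinv.const_mul _))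
      ((hDc.intervalIntegrable _ _).const_mul _),
      intervalIntegral.integral_add intervalIntegrable_const (hinv.const_mul _),
      intervalIntegral.integral_const_mul, intervalIntegral.integral_const_mul,
      integral_one_div_of_pos (by linarith) hT, intervalIntegral.integral_const, smul_eq_mul]
  have hDint : -(6 * logZetaSum q p) ≤ ∫ t in R..T, D t := by
    have h1 := (abs_le.1 (h.abs_integral_log_norm_sub_le hp1 hpp R T)).1
    have h2 : 2 * (p' - p) = 6 := by rw [hp, hp']; ring
    rwa [h2] at h1
  have hlow : Z.card * (3 / 2 * π * η) ≤ (∫ t in R..T, S t) + 3 / 2 * (S R + S T) := by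
    simp only [hS]
    have hci : ∀ ρ ∈ Z, IntervalIntegrable
        (fun t => π * η / 2 * (1 / Real.cosh (π / 3 * (t - ρ.im)))) MeasureTheory.volume R T :=
      fun ρ _ => (continuous_const.mul (continuous_inv_cosh _ _)).intervalIntegrable _ _
    rw [intervalIntegral.integral_finsetSum hci,
      ← Finset.sum_add_distrib, Finset.mul_sum, ← Finset.sum_add_distrib, ← nsmul_eq_mul]
    refine Finset.card_nsmul_le_sum _ _ _ fun ρ hρ => ?_
    have h1 := pi_div_le_integral_inv_cosh_add (c := π / 3) (by positivity) (hI ρ hρ).1 (hI ρ hρ).2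
    rw [show π / (π / 3) = 3 by field_simp, show π / (2 * (π / 3)) = 3 / 2 by field_simp] at h1
    rw [intervalIntegral.integral_const_mul]
    have h2 := mul_le_mul_of_nonneg_left h1 (by positivity : 0 ≤ π * η / 2)
    linarith
  have h5R : 1 / R ≤ 1 / 5 := one_div_le_one_div_of_le (by norm_num) hR
  have h5T : 1 / T ≤ 1 / 5 := one_div_le_one_div_of_le (by norm_num) (hR.trans hRT)
  linarith [hDle R, hDle T]

theorem card_zeros_upper_le (h : IsAxiomA q κ A θ) (hA1 : 1 ≤ A + κ) {η R T : ℝ} (hη : 0 < η)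
    (hη1 : θ + η < 1) (hR : 5 ≤ R) (hRT : R ≤ T) (Z : Finset ℂ)
    (hZ : ∀ ρ ∈ Z, ρ ≠ 1 ∧ θ + η ≤ ρ.re ∧ bZeta q κ ρ = 0) (hI : ∀ ρ ∈ Z, R ≤ ρ.im ∧ ρ.im ≤ T) :
    (Z.card : ℝ) ≤ 1 / η * (2 / (3 * π) * (T - R) * Real.log (11.4 * (A + κ) ^ 2 * T / η) +
      8 / 3 * Real.log (60 * (A + κ) ^ 2 * T / η)) := by
  have h0 := h.card_zeros_mul_le hA1 hη hη1 hR hRT Z hZ hI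
  have hθ := h.theta_pos
  have hAκ : 0 < A + κ := by linarith
  have hT : 0 < T := by linarith
  have hR0 : 0 < R := by linarith
  have hpi := Real.pi_gt_three
  have hlogA := Real.log_nonneg hA1
  have hlogT : 0 ≤ Real.log T := Real.log_nonneg (by linarith)
  have hlogη : Real.log η ≤ 0 := Real.log_nonpos hη.le (by linarith)
  have hlogR : 0 ≤ Real.log R := Real.log_nonneg (by linarith)
  have hexp : ∀ c : ℝ, 0 < c → Real.log (c * (A + κ) ^ 2 * T / η) =
      Real.log c + 2 * Real.log (A + κ) + Real.log T - Real.log η := fun c hc => by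
    rw [Real.log_div (by positivity) hη.ne', Real.log_mul (by positivity) hT.ne',
      Real.log_mul hc.ne' (by positivity), Real.log_pow]
    norm_num
  have h60 : 5 * Real.log 2 ≤ Real.log 60 := by
    rw [show (5 : ℝ) * Real.log 2 = Real.log (2 ^ 5) by rw [Real.log_pow]; norm_num]
    exact Real.log_le_log (by norm_num) (by norm_num)
  have h3 : 3 * Real.log 3 ≤ Real.log 60 := by
    rw [show (3 : ℝ) * Real.log 3 = Real.log (3 ^ 3) by rw [Real.log_pow]; norm_num]
    exact Real.log_le_log (by norm_num) (by norm_num)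
  have h96 : Real.log 9.6 ≤ Real.log 60 := Real.log_le_log (by norm_num) (by norm_num)
  have h114 : Real.log 9.6 ≤ Real.log 11.4 := Real.log_le_log (by norm_num) (by norm_num)
  have hlog2 := Real.log_two_gt_d9
  have hL1 : (T - R) * Real.log (9.6 * (A + κ) ^ 2 * T / η) ≤
      (T - R) * Real.log (11.4 * (A + κ) ^ 2 * T / η) := by
    rw [hexp _ (by norm_num), hexp _ (by norm_num)]
    exact mul_le_mul_of_nonneg_left (by linarith) (by linarith)
  have hL2 : 12 * Real.log (60 * (A + κ) ^ 2 * T / η) ≤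
      4 * π * Real.log (60 * (A + κ) ^ 2 * T / η) := by
    have : 0 ≤ Real.log (60 * (A + κ) ^ 2 * T / η) := by
      rw [hexp _ (by norm_num)]
      linarith
    exact mul_le_mul_of_nonneg_right (by linarith) this
  have hL3 : 5.125 * Real.log (T / R) + 3 * Real.log (9.6 * (A + κ) ^ 2 * T / η) + 3.075 +
      18 * Real.log (3 * (A + κ)) ≤ 12 * Real.log (60 * (A + κ) ^ 2 * T / η) := by
    rw [hexp _ (by norm_num), hexp _ (by norm_num), Real.log_div hT.ne' hR0.ne',
      Real.log_mul (by norm_num) hAκ.ne']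
    linarith
  have hfin : (Z.card : ℝ) * (3 / 2 * π * η) ≤
      (T - R) * Real.log (11.4 * (A + κ) ^ 2 * T / η) +
        4 * π * Real.log (60 * (A + κ) ^ 2 * T / η) := by linarith
  rw [← le_div_iff₀ (by positivity)] at hfin
  refine hfin.trans (le_of_eq ?_)
  field_simp
  ring

end IsAxiomA

theorem Set.finite_and_ncard_le_of_forall_finset {α : Type*} {s : Set α} {K : ℝ}
    (h : ∀ t : Finset α, ↑t ⊆ s → (t.card : ℝ) ≤ K) : s.Finite ∧ (s.ncard : ℝ) ≤ K := by
  have hfin : s.Finite := by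
    by_contra hs
    obtain ⟨n, hn⟩ := exists_nat_gt K
    obtain ⟨t, hts, htc⟩ := Set.Infinite.exists_subset_card_eq hs n
    have := h t hts
    rw [htc] at this
    linarith
  refine ⟨hfin, ?_⟩
  rw [Set.ncard_eq_toFinset_card _ hfin]
  exact h _ (by simp)

theorem statement_14
    (q : ℕ → ℝ) (hq : ∀ i, 1 < q i)
    (hfin : ∀ x : ℝ, {g : ℕ →₀ ℕ | bNorm q g ≤ x}.Finite)
    (κ A θ : ℝ) (hκ : 0 < κ) (hA : 0 < A) (hθ0 : 0 < θ) (hθ1 : θ < 1)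
    (hAxiomA : ∀ x : ℝ, 1 ≤ x → |bR q κ x| ≤ A * x ^ θ)
    (hAκ : 1 ≤ A + κ) (b R T : ℝ) (hb : θ < b) (hb1 : b < 1) (hR : 5 ≤ R) (hRT : R < T) :
    {ρ : ℂ | ρ ≠ 1 ∧ b ≤ ρ.re ∧ R ≤ |ρ.im| ∧ |ρ.im| ≤ T ∧ bZeta q κ ρ = 0}.Finite ∧
    ({ρ : ℂ | ρ ≠ 1 ∧ b ≤ ρ.re ∧ R ≤ |ρ.im| ∧ |ρ.im| ≤ T ∧ bZeta q κ ρ = 0}.ncard : ℝ) ≤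
      1 / (b - θ) *
        (4 / (3 * Real.pi) * (T - R) * Real.log (11.4 * (A + κ) ^ 2 * T / (b - θ)) +
          16 / 3 * Real.log (60 * (A + κ) ^ 2 * T / (b - θ))) := by
  have h : IsAxiomA q κ A θ := ⟨hq, hfin, hκ, hA, hθ0, hθ1, hAxiomA⟩
  have hη : 0 < b - θ := sub_pos.2 hb
  obtain ⟨hf, hn⟩ := Set.finite_and_ncard_le_of_forall_finset
    (s := {ρ : ℂ | ρ ≠ 1 ∧ b ≤ ρ.re ∧ R ≤ ρ.im ∧ ρ.im ≤ T ∧ bZeta q κ ρ = 0})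
    fun Z hZ => h.card_zeros_upper_le hAκ hη (by linarith) hR hRT.le Z
      (fun ρ hρ => ⟨(hZ hρ).1, by linarith [(hZ hρ).2.1], (hZ hρ).2.2.2.2⟩)
      fun ρ hρ => ⟨(hZ hρ).2.2.1, (hZ hρ).2.2.2.1⟩
  set Zu := {ρ : ℂ | ρ ≠ 1 ∧ b ≤ ρ.re ∧ R ≤ ρ.im ∧ ρ.im ≤ T ∧ bZeta q κ ρ = 0} with hZu
  have hsub : {ρ : ℂ | ρ ≠ 1 ∧ b ≤ ρ.re ∧ R ≤ |ρ.im| ∧ |ρ.im| ≤ T ∧ bZeta q κ ρ = 0} ⊆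
      Zu ∪ (starRingEnd ℂ) '' Zu := by
    rintro ρ ⟨h1, h2, h3, h4, h5⟩
    rcases le_total 0 ρ.im with hi | hi
    · rw [abs_of_nonneg hi] at h3 h4
      exact Or.inl ⟨h1, h2, h3, h4, h5⟩
    · rw [abs_of_nonpos hi] at h3 h4
      refine Or.inr ⟨(starRingEnd ℂ) ρ, ⟨?_, h2, h3, h4, ?_⟩, Complex.conj_conj ρ⟩
      · exact fun h6 => h1 (by simpa using congrArg (starRingEnd ℂ) h6)
      · rw [bZeta_conj, h5, map_zero]
  have hfu : (Zu ∪ (starRingEnd ℂ) '' Zu).Finite := hf.union (hf.image _)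
  refine ⟨hfu.subset hsub, ?_⟩
  have hcard : ({ρ : ℂ | ρ ≠ 1 ∧ b ≤ ρ.re ∧ R ≤ |ρ.im| ∧ |ρ.im| ≤ T ∧
      bZeta q κ ρ = 0}.ncard : ℝ) ≤ Zu.ncard + Zu.ncard := by
    exact_mod_cast (Set.ncard_le_ncard hsub hfu).trans ((Set.ncard_union_le _ _).trans
      (Nat.add_le_add_left (Set.ncard_image_le hf) _))
  refine hcard.trans ((add_le_add hn hn).trans (le_of_eq ?_))
  field_simp
  ring
end
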